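/- arXiv:2110.00102 — 4 statements merged into one kernel-verified Lean document; each statement's English description precedes it below -/
import Mathlib

section
/- Let 𝔽_q be a finite field and let B ∈ 𝔽_q[T] be nonzero. There exist real numbers a > 0 and b₀, b₁, b₂ such that for every ε > 0 there is a constant C_ε with | #F_N(B) − (a·N + b_{N mod 3})·q^N | ≤ C_ε · q^{(1/2 + ε)N} for all N ≥ 1. In particular, #F_N(B) ∼ a·N·q^N as N → ∞. -/
open Polynomial UniqueFactorizationMonoid

/-- `D` is cube-free: no monic irreducible polynomial `P` satisfies `P³ ∣ D`. -/
def Polynomial.CubeFree {Fq : Type*} [Field Fq] (D : Fq[X]) : Prop :=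
  ∀ P : Fq[X], P.Monic → Irreducible P → ¬P ^ 3 ∣ D

/-- `deg(rad D)`: the sum of the degrees of the distinct monic irreducible divisors of `D`. -/
noncomputable def Polynomial.radDeg {Fq : Type*} [Field Fq] [DecidableEq Fq] (D : Fq[X]) : ℕ :=
  ∑ P ∈ (normalizedFactors D).toFinset, P.natDegree

/-- The family `F_N(B)`: monic cube-free polynomials coprime to `B` with
`deg(rad D) = N` and `3 ∣ deg D`. -/
def cubicTwistFamily {Fq : Type*} [Field Fq] [DecidableEq Fq] (B : Fq[X]) (N : ℕ) :
    Set (Fq[X]) :=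
  {D | D.Monic ∧ D.CubeFree ∧ IsCoprime D B ∧ D.radDeg = N ∧ 3 ∣ D.natDegree}

namespace CubicFamily

open Finset

section Sieve

variable {F : Type*} [Field F]

theorem finite_monic_natDegree_eq (F : Type*) [Field F] [Finite F] (n : ℕ) :
    {D : F[X] | D.Monic ∧ D.natDegree = n}.Finite :=
  have : Finite ↥{D : F[X] | D.Monic ∧ D.natDegree = n} :=
    Finite.of_equiv _ ((monicEquivDegreeLT n).trans (degreeLTEquiv F n).toEquiv).symm
  Set.toFinite _

variable [Fintype F]

/-- The monic polynomials of degree `n` over a finite field. -/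
noncomputable def monics (F : Type*) [Field F] [Fintype F] (n : ℕ) : Finset F[X] :=
  (finite_monic_natDegree_eq F n).toFinset

theorem mem_monics {n : ℕ} {D : F[X]} : D ∈ monics F n ↔ D.Monic ∧ D.natDegree = n := by
  simp [monics]

theorem card_monics (n : ℕ) : (monics F n).card = Fintype.card F ^ n := by
  rw [monics, ← Set.ncard_eq_toFinset_card _ (finite_monic_natDegree_eq F n), ← Nat.card_coe_set_eq]
  change Nat.card {p : F[X] // p.Monic ∧ p.natDegree = n} = _
  rw [Nat.card_congr ((monicEquivDegreeLT n).trans (degreeLTEquiv F n).toEquiv)]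
  simp

open Classical in
/-- The monic irreducible polynomials of degree at most `M`. -/
noncomputable def primesUpTo (F : Type*) [Field F] [Fintype F] (M : ℕ) : Finset F[X] :=
  ((range (M + 1)).biUnion (monics F)).filter Irreducible

theorem mem_primesUpTo {M : ℕ} {P : F[X]} :
    P ∈ primesUpTo F M ↔ P.Monic ∧ Irreducible P ∧ P.natDegree ≤ M := by
  simp [primesUpTo, mem_monics]
  tauto

theorem sum_primesUpTo_pow_le {r : ℝ} (hr : 0 ≤ r) (hr1 : (Fintype.card F : ℝ) * r < 1) (M : ℕ) :
    ∑ P ∈ primesUpTo F M, r ^ P.natDegree ≤ (1 - Fintype.card F * r)⁻¹ := by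
  classical
  calc ∑ P ∈ primesUpTo F M, r ^ P.natDegree
      ≤ ∑ P ∈ (range (M + 1)).biUnion (monics F), r ^ P.natDegree :=
        sum_le_sum_of_subset_of_nonneg (by rw [primesUpTo]; exact filter_subset _ _)
          fun _ _ _ => by positivity
    _ = ∑ n ∈ range (M + 1), ∑ P ∈ monics F n, r ^ P.natDegree := by
        refine sum_biUnion fun i _ j _ hij => disjoint_left.2 fun D hi hj => hij ?_
        rw [← (mem_monics.1 hi).2, ← (mem_monics.1 hj).2]
    _ = ∑ n ∈ range (M + 1), ((Fintype.card F : ℝ) * r) ^ n := by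
        refine sum_congr rfl fun n _ => ?_
        rw [sum_congr rfl fun P hP => by rw [(mem_monics.1 hP).2], sum_const, card_monics,
          mul_pow, nsmul_eq_mul]
        push_cast
        rfl
    _ ≤ ∑' n : ℕ, ((Fintype.card F : ℝ) * r) ^ n :=
        (summable_geometric_of_lt_one (by positivity) hr1).sum_le_tsum _
          fun _ _ => by positivity
    _ = _ := tsum_geometric_of_lt_one (by positivity) hr1

open Classical in
/-- The number of monic polynomials of degree `n` divisible by no member of `S`. -/
noncomputable def siftedCount (S : Finset F[X]) (n : ℕ) : ℕ :=
  ((monics F n).filter fun D => ∀ P ∈ S, ¬P ∣ D).card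

theorem siftedCount_insert {S : Finset F[X]} (hS : ∀ Q ∈ S, Q.Monic ∧ Irreducible Q) {P : F[X]}
    (hP : P.Monic) (hPi : Irreducible P) (hPS : P ∉ S) [DecidableEq F[X]] (n : ℕ) :
    siftedCount S n = siftedCount (insert P S) n +
      if P.natDegree ≤ n then siftedCount S (n - P.natDegree) else 0 := by
  classical
  have hcop : ∀ Q ∈ S, ∀ D, Q ∣ P * D ↔ Q ∣ D := fun Q hQ D => by
    refine ⟨fun h => ((hS Q hQ).2.prime.dvd_or_dvd h).resolve_left fun h => hPS ?_,
      fun h => h.mul_left _⟩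
    rwa [← eq_of_monic_of_associated (hS Q hQ).1 hP ((hS Q hQ).2.associated_of_dvd hPi h)]
  unfold siftedCount
  rw [← card_filter_add_card_filter_not (s := (monics F n).filter fun D => ∀ Q ∈ S, ¬Q ∣ D)
    (fun D => ¬P ∣ D)]
  congr 1
  · congr 1
    ext D
    simp only [mem_filter, mem_insert, forall_eq_or_imp]
    tauto
  · split_ifs with h
    · symm
      refine card_bij (fun D _ => P * D) ?_ ?_ ?_
      · intro D hD
        simp only [mem_filter, mem_monics, not_not] at hD ⊢
        refine ⟨⟨⟨hP.mul hD.1.1, ?_⟩, fun Q hQ => ?_⟩, dvd_mul_right _ _⟩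
        · rw [hP.natDegree_mul hD.1.1, hD.1.2]; omega
        · rw [hcop Q hQ]; exact hD.2 Q hQ
      · intro D _ E _ h
        exact mul_left_cancel₀ hP.ne_zero h
      · intro D hD
        simp only [mem_filter, mem_monics, not_not] at hD
        obtain ⟨⟨⟨hD1, hD2⟩, hD3⟩, E, rfl⟩ := hD
        have hE : E.Monic := hP.of_mul_monic_left hD1
        refine ⟨E, ?_, rfl⟩
        simp only [mem_filter, mem_monics]
        refine ⟨⟨hE, ?_⟩, fun Q hQ => ?_⟩
        · rw [hP.natDegree_mul hE] at hD2; omega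
        · rw [← hcop Q hQ]; exact hD3 Q hQ
    · rw [card_eq_zero, filter_eq_empty_iff]
      intro D hD
      simp only [mem_filter, mem_monics] at hD
      rw [not_not]
      intro hPD
      exact h (hD.1.2 ▸ natDegree_le_of_dvd hPD hD.1.1.ne_zero)

theorem mk_siftedCount (S : Finset F[X]) (hS : ∀ Q ∈ S, Q.Monic ∧ Irreducible Q) :
    PowerSeries.mk (fun n => (siftedCount S n : ℂ)) =
      (∏ P ∈ S, (1 - PowerSeries.X ^ P.natDegree)) *
        PowerSeries.mk (fun n => (Fintype.card F : ℂ) ^ n) := by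
  classical
  induction S using Finset.induction_on with
  | empty => ext n; simp [siftedCount, card_monics]
  | insert P S hPS ih =>
    have hS' : ∀ Q ∈ S, Q.Monic ∧ Irreducible Q := fun Q hQ => hS Q (mem_insert_of_mem hQ)
    have hP := hS P (mem_insert_self _ _)
    rw [prod_insert hPS, mul_assoc, ← ih hS']
    ext n
    have := siftedCount_insert hS' hP.1 hP.2 hPS n
    rw [sub_mul, one_mul, map_sub, PowerSeries.coeff_X_pow_mul', PowerSeries.coeff_mk,
      PowerSeries.coeff_mk, this]
    split_ifs <;> simp

theorem siftedCount_primesUpTo {M n : ℕ} (hn : n ≤ M) :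
    siftedCount (primesUpTo F M) n = if n = 0 then 1 else 0 := by
  classical
  unfold siftedCount
  split_ifs with h
  · subst h
    rw [card_eq_one]
    refine ⟨1, ?_⟩
    ext D
    simp only [mem_filter, mem_monics, mem_singleton, mem_primesUpTo]
    refine ⟨fun h => h.1.1.natDegree_eq_zero.1 h.1.2, ?_⟩
    rintro rfl
    exact ⟨⟨monic_one, natDegree_one⟩, fun P hP h => hP.2.1.not_isUnit (isUnit_of_dvd_one h)⟩
  · rw [card_eq_zero, filter_eq_empty_iff]
    intro D hD hD'
    rw [mem_monics] at hD
    obtain ⟨P, hPm, hPi, hPD⟩ := exists_monic_irreducible_factor D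
      fun hu => h (hD.2 ▸ natDegree_eq_zero_of_isUnit hu)
    exact hD' P (mem_primesUpTo.2
      ⟨hPm, hPi, (natDegree_le_of_dvd hPD hD.1.ne_zero).trans (hD.2 ▸ hn)⟩) hPD

/-- The truncated Euler product for the inverse zeta function of `F[X]`. -/
theorem X_pow_dvd_prod_primesUpTo_sub (M : ℕ) :
    (PowerSeries.X : PowerSeries ℂ) ^ (M + 1) ∣
      (∏ P ∈ primesUpTo F M, (1 - PowerSeries.X ^ P.natDegree)) -
        (1 - PowerSeries.C (Fintype.card F : ℂ) * PowerSeries.X) := by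
  set q : ℂ := (Fintype.card F : ℂ)
  have hZ : PowerSeries.mk (fun n => q ^ n) * (1 - PowerSeries.C q * PowerSeries.X) = 1 := by
    ext n
    rw [mul_sub, mul_one, mul_left_comm, map_sub, PowerSeries.coeff_C_mul]
    cases n with
    | zero => simp
    | succ n => simp [PowerSeries.coeff_succ_mul_X, pow_succ', PowerSeries.coeff_one]
  have h : (PowerSeries.X : PowerSeries ℂ) ^ (M + 1) ∣
      (∏ P ∈ primesUpTo F M, (1 - PowerSeries.X ^ P.natDegree)) *
        PowerSeries.mk (fun n => q ^ n) - 1 := by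
    rw [← mk_siftedCount _ fun P hP => ⟨(mem_primesUpTo.1 hP).1, (mem_primesUpTo.1 hP).2.1⟩,
      PowerSeries.X_pow_dvd_iff]
    intro m hm
    rw [map_sub, PowerSeries.coeff_mk, siftedCount_primesUpTo (Nat.lt_succ_iff.1 hm),
      PowerSeries.coeff_one]
    split_ifs <;> simp
  convert h.mul_right (1 - PowerSeries.C q * PowerSeries.X) using 1
  rw [sub_mul, mul_assoc, hZ, mul_one, one_mul]

end Sieve

section Parametrization

variable {F : Type*} [Field F] [DecidableEq F]

theorem pow_dvd_iff_le_count_normalizedFactors {D P : F[X]} (hD : D ≠ 0) (hP : P.Monic)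
    (hPi : Irreducible P) (k : ℕ) : P ^ k ∣ D ↔ k ≤ (normalizedFactors D).count P := by
  rw [dvd_iff_normalizedFactors_le_normalizedFactors (pow_ne_zero _ hP.ne_zero) hD,
    normalizedFactors_of_irreducible_pow hPi, hP.normalize_eq_self,
    Multiset.le_count_iff_replicate_le]

theorem monic_and_irreducible_of_mem_normalizedFactors {D P : F[X]}
    (hP : P ∈ normalizedFactors D) : P.Monic ∧ Irreducible P := by
  have hi := irreducible_of_normalized_factor P hP
  refine ⟨?_, hi⟩
  rw [← normalize_normalized_factor P hP]
  exact monic_normalize hi.ne_zero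

theorem prod_normalizedFactors_of_monic {D : F[X]} (hD : D.Monic) :
    (normalizedFactors D).prod = D := by
  rw [prod_normalizedFactors_eq hD.ne_zero, hD.normalize_eq_self]

theorem cubeFree_iff_count_le {D : F[X]} (hD : D ≠ 0) :
    D.CubeFree ↔ ∀ P, (normalizedFactors D).count P ≤ 2 := by
  refine ⟨fun h P => ?_, fun h P hP hPi hdvd => ?_⟩
  · by_contra! hc
    have hP := monic_and_irreducible_of_mem_normalizedFactors
      (Multiset.count_pos.1 (by omega : 0 < (normalizedFactors D).count P))
    exact h P hP.1 hP.2 ((pow_dvd_iff_le_count_normalizedFactors hD hP.1 hP.2 3).2 hc)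
  · have := (pow_dvd_iff_le_count_normalizedFactors hD hP hPi 3).1 hdvd
    have := h P
    omega

/-- The multiset of primes in which `P ∈ S` occurs with multiplicity `f P`. -/
def factorMultiset (S : Finset F[X]) (f : S → Fin 3) : Multiset F[X] :=
  ∑ P : S, (f P : ℕ) • {(P : F[X])}

theorem count_factorMultiset {S : Finset F[X]} (f : S → Fin 3) (P : S) :
    (factorMultiset S f).count (P : F[X]) = f P := by
  rw [factorMultiset, Multiset.count_sum', Finset.sum_eq_single P]
  · simp
  · intro Q _ hQ
    rw [Multiset.count_nsmul, Multiset.count_singleton, if_neg fun h => hQ (Subtype.ext h.symm),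
      mul_zero]
  · simp

omit [DecidableEq F] in
theorem mem_of_mem_factorMultiset {S : Finset F[X]} {f : S → Fin 3} {P : F[X]}
    (h : P ∈ factorMultiset S f) : P ∈ S := by
  obtain ⟨Q, -, hQ⟩ := Multiset.mem_sum.1 h
  rw [Multiset.mem_singleton.1 (Multiset.mem_of_mem_nsmul hQ)]
  exact Q.2

theorem normalizedFactors_prod_factorMultiset {S : Finset F[X]}
    (hS : ∀ P ∈ S, P.Monic ∧ Irreducible P) (f : S → Fin 3) :
    normalizedFactors (factorMultiset S f).prod = factorMultiset S f := by
  rw [normalizedFactors_prod_eq _ fun P hP => (hS P (mem_of_mem_factorMultiset hP)).2]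
  conv_rhs => rw [← Multiset.map_id (factorMultiset S f)]
  exact Multiset.map_congr rfl fun P hP =>
    (hS P (mem_of_mem_factorMultiset hP)).1.normalize_eq_self

omit [DecidableEq F] in
theorem monic_prod_factorMultiset {S : Finset F[X]}
    (hS : ∀ P ∈ S, P.Monic ∧ Irreducible P) (f : S → Fin 3) :
    (factorMultiset S f).prod.Monic := by
  rw [← Multiset.map_id (factorMultiset S f)]
  exact monic_multiset_prod_of_monic _ _ fun P hP => (hS P (mem_of_mem_factorMultiset hP)).1

theorem prod_factorMultiset_injective {S : Finset F[X]}
    (hS : ∀ P ∈ S, P.Monic ∧ Irreducible P) :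
    Function.Injective fun f : S → Fin 3 => (factorMultiset S f).prod := by
  intro f g h
  have h' : factorMultiset S f = factorMultiset S g := by
    simp only at h
    rw [← normalizedFactors_prod_factorMultiset hS f, h,
      normalizedFactors_prod_factorMultiset hS g]
  ext P
  rw [← count_factorMultiset f, h', count_factorMultiset]

omit [DecidableEq F] in
theorem natDegree_prod_factorMultiset {S : Finset F[X]}
    (hS : ∀ P ∈ S, P.Monic ∧ Irreducible P) (f : S → Fin 3) :
    (factorMultiset S f).prod.natDegree = ∑ P : S, (f P : ℕ) * (P : F[X]).natDegree := by
  rw [factorMultiset, Multiset.prod_sum, natDegree_prod_of_monic]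
  · refine sum_congr rfl fun P _ => ?_
    rw [Multiset.prod_nsmul, Multiset.prod_singleton, natDegree_pow]
  · intro P _
    rw [Multiset.prod_nsmul, Multiset.prod_singleton]
    exact (hS P P.2).1.pow _

theorem radDeg_prod_factorMultiset {S : Finset F[X]}
    (hS : ∀ P ∈ S, P.Monic ∧ Irreducible P) (f : S → Fin 3) :
    (factorMultiset S f).prod.radDeg = ∑ P : S, if f P = 0 then 0 else (P : F[X]).natDegree := by
  rw [radDeg, normalizedFactors_prod_factorMultiset hS]
  have hsub : (factorMultiset S f).toFinset ⊆ S := fun P hP =>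
    mem_of_mem_factorMultiset (Multiset.mem_toFinset.1 hP)
  rw [← inter_eq_right.2 hsub, ← sum_ite_mem, ← sum_coe_sort S]
  refine sum_congr rfl fun P _ => ?_
  simp only [Multiset.mem_toFinset, ← Multiset.count_ne_zero, count_factorMultiset f P, ne_eq,
    Fin.val_eq_zero_iff, ite_not]

/-- The monic cube-free polynomials coprime to `B` whose radical has degree `N`. -/
def cubeFreeFamily (B : F[X]) (N : ℕ) : Set F[X] :=
  {D | D.Monic ∧ D.CubeFree ∧ IsCoprime D B ∧ D.radDeg = N}

variable [Fintype F]

open Classical in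
/-- The monic irreducible polynomials of degree at most `M` not dividing `B`. -/
noncomputable def primesUpToCoprime (B : F[X]) (M : ℕ) : Finset F[X] :=
  {P ∈ primesUpTo F M | ¬P ∣ B}

omit [DecidableEq F] in
theorem mem_primesUpToCoprime {B P : F[X]} {M : ℕ} :
    P ∈ primesUpToCoprime B M ↔ P ∈ primesUpTo F M ∧ ¬P ∣ B := by
  simp [primesUpToCoprime]

omit [DecidableEq F] in
theorem monic_and_irreducible_of_mem_primesUpToCoprime {B P : F[X]} {M : ℕ}
    (hP : P ∈ primesUpToCoprime B M) : P.Monic ∧ Irreducible P :=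
  have h := mem_primesUpTo.1 (mem_primesUpToCoprime.1 hP).1
  ⟨h.1, h.2.1⟩

theorem cubeFreeFamily_eq_image (B : F[X]) {N M : ℕ} (hN : N ≤ M) :
    cubeFreeFamily B N = (fun f => (factorMultiset (primesUpToCoprime B M) f).prod) ''
      ↑(univ.filter fun f : primesUpToCoprime B M → Fin 3 =>
        (∑ P, if f P = 0 then 0 else (P : F[X]).natDegree) = N) := by
  set S := primesUpToCoprime B M with hSdef
  have hS : ∀ P ∈ S, P.Monic ∧ Irreducible P := fun _ =>
    monic_and_irreducible_of_mem_primesUpToCoprime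
  ext D
  simp only [Set.mem_image, mem_coe, mem_filter, mem_univ, true_and]
  constructor
  · rintro ⟨hD, hcf, hcop, hrad⟩
    rw [cubeFree_iff_count_le hD.ne_zero] at hcf
    let f : S → Fin 3 := fun P =>
      ⟨(normalizedFactors D).count (P : F[X]), Nat.lt_succ_iff.2 (hcf P)⟩
    have hf : factorMultiset S f = normalizedFactors D := by
      ext P
      by_cases hP : P ∈ S
      · exact count_factorMultiset f ⟨P, hP⟩
      · rw [Multiset.count_eq_zero_of_notMem fun h => hP (mem_of_mem_factorMultiset h),
          Multiset.count_eq_zero_of_notMem]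
        intro hPD
        obtain ⟨hPm, hPi⟩ := monic_and_irreducible_of_mem_normalizedFactors hPD
        refine hP (mem_primesUpToCoprime.2
          ⟨mem_primesUpTo.2 ⟨hPm, hPi, le_trans ?_ hN⟩, fun hPB => ?_⟩)
        · rw [← hrad, radDeg]
          exact single_le_sum (f := fun P : F[X] => P.natDegree) (fun _ _ => Nat.zero_le _)
            (Multiset.mem_toFinset.2 hPD)
        · exact hPi.not_isUnit (hcop.isUnit_of_dvd' (dvd_of_mem_normalizedFactors hPD) hPB)
    have hfD : (factorMultiset S f).prod = D := by rw [hf, prod_normalizedFactors_of_monic hD]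
    exact ⟨f, by rw [← radDeg_prod_factorMultiset hS, hfD, hrad], hfD⟩
  · rintro ⟨f, hf, rfl⟩
    have hm := monic_prod_factorMultiset hS f
    refine ⟨hm, ?_, ?_, by rw [radDeg_prod_factorMultiset hS, hf]⟩
    · rw [cubeFree_iff_count_le hm.ne_zero, normalizedFactors_prod_factorMultiset hS]
      intro P
      by_cases hP : P ∈ S
      · have := (f ⟨P, hP⟩).2
        rw [count_factorMultiset f ⟨P, hP⟩]
        omega
      · rw [Multiset.count_eq_zero_of_notMem fun h => hP (mem_of_mem_factorMultiset h)]
        omega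
    · rw [factorMultiset, Multiset.prod_sum]
      refine IsCoprime.prod_left fun P _ => ?_
      rw [Multiset.prod_nsmul, Multiset.prod_singleton]
      exact ((hS P P.2).2.coprime_iff_not_dvd.2 (mem_primesUpToCoprime.1 P.2).2).pow_left

theorem finite_cubeFreeFamily (B : F[X]) (N : ℕ) : (cubeFreeFamily B N).Finite := by
  rw [cubeFreeFamily_eq_image B le_rfl]
  exact (finite_toSet _).image _

/-- The sum of `α ^ deg D` over the monic cube-free `D` coprime to `B` with `deg (rad D) = N`. -/
noncomputable def twistedCount (B : F[X]) (α : ℂ) (N : ℕ) : ℂ :=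
  ∑ D ∈ (finite_cubeFreeFamily B N).toFinset, α ^ D.natDegree

theorem twistedCount_eq_coeff (B : F[X]) (α : ℂ) {N M : ℕ} (hN : N ≤ M) :
    twistedCount B α N = (∏ P ∈ primesUpToCoprime B M,
      (1 + C (α ^ P.natDegree + (α ^ 2) ^ P.natDegree) * X ^ P.natDegree)).coeff N := by
  have hS : ∀ P ∈ primesUpToCoprime B M, P.Monic ∧ Irreducible P := fun _ =>
    monic_and_irreducible_of_mem_primesUpToCoprime
  have hfac : ∀ d : ℕ, (1 + C (α ^ d + (α ^ 2) ^ d) * X ^ d : ℂ[X]) =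
      ∑ e : Fin 3, C (α ^ ((e : ℕ) * d)) * X ^ (if e = 0 then 0 else d) := fun d => by
    rw [Fin.sum_univ_three, ← pow_mul]
    simp [add_mul, add_assoc]
  have himage : (finite_cubeFreeFamily B N).toFinset =
      (univ.filter fun f : primesUpToCoprime B M → Fin 3 =>
        (∑ P, if f P = 0 then 0 else (P : F[X]).natDegree) = N).image
      fun f => (factorMultiset (primesUpToCoprime B M) f).prod := by
    apply Finset.coe_injective
    rw [Set.Finite.coe_toFinset, coe_image, cubeFreeFamily_eq_image B hN]
  rw [twistedCount, himage, sum_image (prod_factorMultiset_injective hS).injOn,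
    ← prod_coe_sort]
  simp_rw [hfac]
  rw [Fintype.prod_sum, finsetSum_coeff, sum_filter]
  refine sum_congr rfl fun f _ => ?_
  rw [prod_mul_distrib, prod_pow_eq_pow_sum, ← map_prod, coeff_C_mul_X_pow,
    natDegree_prod_factorMultiset hS, prod_pow_eq_pow_sum]
  simp only [eq_comm]

end Parametrization

section EulerProduct

/-- Coefficientwise domination of a complex polynomial by a real one. -/
def Majorizes (Q : ℝ[X]) (p : ℂ[X]) : Prop :=
  ∀ k, ‖p.coeff k‖ ≤ Q.coeff k

theorem majorizes_C_mul_X_pow {c : ℂ} {c' : ℝ} (h : ‖c‖ ≤ c') (n : ℕ) :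
    Majorizes (C c' * X ^ n) (C c * X ^ n) := fun k => by
  rw [coeff_C_mul_X_pow, coeff_C_mul_X_pow]
  split_ifs <;> simp [h]

theorem majorizes_one : Majorizes 1 1 := by
  simpa using majorizes_C_mul_X_pow (c := 1) (c' := 1) (by simp) 0

theorem Majorizes.add {Q Q' : ℝ[X]} {p p' : ℂ[X]} (h : Majorizes Q p) (h' : Majorizes Q' p') :
    Majorizes (Q + Q') (p + p') := fun k => by
  rw [coeff_add, coeff_add]
  exact (norm_add_le _ _).trans (add_le_add (h k) (h' k))

theorem Majorizes.mul {Q Q' : ℝ[X]} {p p' : ℂ[X]} (h : Majorizes Q p) (h' : Majorizes Q' p') :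
    Majorizes (Q * Q') (p * p') := fun k => by
  rw [coeff_mul, coeff_mul]
  refine (norm_sum_le _ _).trans (sum_le_sum fun x _ => ?_)
  rw [norm_mul]
  exact mul_le_mul (h _) (h' _) (norm_nonneg _) ((norm_nonneg _).trans (h _))

theorem majorizes_prod {ι : Type*} {s : Finset ι} {Q : ι → ℝ[X]} {p : ι → ℂ[X]}
    (h : ∀ i ∈ s, Majorizes (Q i) (p i)) : Majorizes (∏ i ∈ s, Q i) (∏ i ∈ s, p i) := by
  classical
  induction s using Finset.induction_on with
  | empty => simpa using majorizes_one
  | insert i s hi ih =>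
    rw [prod_insert hi, prod_insert hi]
    exact (h i (mem_insert_self _ _)).mul (ih fun j hj => h j (mem_insert_of_mem hj))

theorem Majorizes.norm_coeff_mul_pow_le {Q : ℝ[X]} {p : ℂ[X]} (h : Majorizes Q p) {r : ℝ}
    (hr : 0 ≤ r) (k : ℕ) : ‖p.coeff k‖ * r ^ k ≤ Q.eval r := by
  have hQ : ∀ i, 0 ≤ Q.coeff i := fun i => (norm_nonneg _).trans (h i)
  rw [eval_eq_sum_range' (n := max (Q.natDegree + 1) (k + 1)) (by simp)]
  refine (mul_le_mul_of_nonneg_right (h k) (by positivity)).trans ?_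
  exact single_le_sum (f := fun i => Q.coeff i * r ^ i)
    (fun i _ => mul_nonneg (hQ i) (by positivity)) (by simp)

variable {F : Type*} [Field F]

open Classical in
/-- The local factor at `P` left over after dividing out the zeta functions twisted by `α` and
`α ^ 2`. -/
noncomputable def eulerFactor (B : F[X]) (α : ℂ) (P : F[X]) : ℂ[X] :=
  (1 - C (α ^ P.natDegree) * X ^ P.natDegree) * (1 - C ((α ^ 2) ^ P.natDegree) * X ^ P.natDegree) *
    if P ∣ B then 1 else 1 + C (α ^ P.natDegree + (α ^ 2) ^ P.natDegree) * X ^ P.natDegree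

open Classical in
theorem exists_majorizes_eulerFactor (B : F[X]) {α : ℂ} (hα : α ^ 3 = 1) (P : F[X]) {r : ℝ}
    (hr : 0 ≤ r) (hr1 : r ≤ 1) : ∃ Q : ℝ[X], Majorizes Q (eulerFactor B α P) ∧ 0 ≤ Q.eval r ∧
      Q.eval r ≤ Real.exp (7 * (r ^ 2) ^ P.natDegree) * if P ∣ B then 4 else 1 := by
  set d := P.natDegree
  have hna : ‖α‖ = 1 := Complex.norm_eq_one_of_pow_eq_one hα (by norm_num)
  set a := α ^ d with ha
  set b := (α ^ 2) ^ d with hb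
  have hab : a * b = 1 := by
    rw [ha, hb, ← mul_pow, ← pow_succ', hα, one_pow]
  have ha1 : ‖a‖ = 1 := by simp [ha, hna]
  have hb1 : ‖b‖ = 1 := by simp [hb, hna]
  have hs : ‖a + b‖ ≤ 2 := (norm_add_le _ _).trans (by rw [ha1, hb1]; norm_num)
  have hCab : (C a * C b : ℂ[X]) = 1 := by rw [← C_mul, hab, C_1]
  have hrd : 0 ≤ r ^ d := by positivity
  have hrd1 : r ^ d ≤ 1 := pow_le_one₀ hr hr1
  have hr2 : (r ^ 2) ^ d = (r ^ d) ^ 2 := by rw [← pow_mul, ← pow_mul, mul_comm]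
  have hexp : 1 + 7 * (r ^ d) ^ 2 ≤ Real.exp (7 * (r ^ d) ^ 2) := by
    linarith [Real.add_one_le_exp (7 * (r ^ d) ^ 2)]
  by_cases hP : P ∣ B
  · refine ⟨1 + C 2 * X ^ d + C 1 * X ^ (2 * d), ?_, ?_, ?_⟩
    · have : eulerFactor B α P = 1 + C (-(a + b)) * X ^ d + C 1 * X ^ (2 * d) := by
        rw [eulerFactor, if_pos hP, C_neg, C_add, C_1, pow_mul' X 2 d, ← ha, ← hb]
        linear_combination (X ^ d) ^ 2 * hCab
      rw [this]
      exact (majorizes_one.add (majorizes_C_mul_X_pow (by rwa [norm_neg]) _)).add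
        (majorizes_C_mul_X_pow (by simp) _)
    · simp only [eval_add, eval_one, eval_mul, eval_C, eval_pow, eval_X]
      positivity
    · simp only [eval_add, eval_one, eval_mul, eval_C, eval_pow, eval_X, if_pos hP, hr2,
        pow_mul' r 2 d]
      nlinarith
  · refine ⟨1 + C 5 * X ^ (2 * d) + C 2 * X ^ (3 * d), ?_, ?_, ?_⟩
    · have : eulerFactor B α P =
          1 + C (1 - (a + b) ^ 2) * X ^ (2 * d) + C (a + b) * X ^ (3 * d) := by
        rw [eulerFactor, if_neg hP, C_sub, C_pow (a := a + b), C_1, pow_mul' X 2 d,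
          pow_mul' X 3 d, ← ha, ← hb, C_add]
        linear_combination ((X ^ d) ^ 2 + (X ^ d) ^ 3 * (C a + C b)) * hCab
      rw [this]
      refine (majorizes_one.add (majorizes_C_mul_X_pow ?_ _)).add (majorizes_C_mul_X_pow hs _)
      refine (norm_sub_le _ _).trans ?_
      rw [norm_one, norm_pow]
      nlinarith [norm_nonneg (a + b)]
    · simp only [eval_add, eval_one, eval_mul, eval_C, eval_pow, eval_X]
      positivity
    · simp only [eval_add, eval_one, eval_mul, eval_C, eval_pow, eval_X, if_neg hP, hr2,
        pow_mul' r 2 d, pow_mul' r 3 d, mul_one]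
      nlinarith [mul_nonneg (sq_nonneg (r ^ d)) (sub_nonneg.2 hrd1)]

variable [Fintype F]

open Classical in
theorem card_primesUpTo_filter_dvd_le {B : F[X]} (hB : B ≠ 0) (M : ℕ) :
    ((primesUpTo F M).filter (· ∣ B)).card ≤ (normalizedFactors B).toFinset.card := by
  refine card_le_card fun P hP => ?_
  obtain ⟨hP, hPB⟩ := mem_filter.1 hP
  obtain ⟨hPm, hPi, -⟩ := mem_primesUpTo.1 hP
  obtain ⟨Q, hQ, hPQ⟩ := exists_mem_normalizedFactors_of_dvd hB hPi hPB
  rw [Multiset.mem_toFinset]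
  have hQm : Q.Monic := by
    rw [← normalize_normalized_factor Q hQ]
    exact monic_normalize (irreducible_of_normalized_factor Q hQ).ne_zero
  rwa [eq_of_monic_of_associated hPm hQm hPQ]

/-- The product of the local factors at the primes of degree at most `M`. -/
noncomputable def eulerProduct (B : F[X]) (α : ℂ) (M : ℕ) : ℂ[X] :=
  ∏ P ∈ primesUpTo F M, eulerFactor B α P

theorem exists_norm_coeff_eulerProduct_le {B : F[X]} (hB : B ≠ 0) {α : ℂ} (hα : α ^ 3 = 1) {ρ : ℝ}
    (hρ : 1 ≤ ρ) (hqρ : Fintype.card F < ρ ^ 2) :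
    ∃ K, ∀ M k, ‖(eulerProduct B α M).coeff k‖ ≤ K * ρ ^ k := by
  classical
  set q : ℝ := (Fintype.card F : ℝ)
  have hρ0 : 0 < ρ := by linarith
  have hr0 : 0 ≤ ρ⁻¹ := by positivity
  have hr1 : ρ⁻¹ ≤ 1 := inv_le_one_of_one_le₀ hρ
  refine ⟨Real.exp (7 * (1 - q * ρ⁻¹ ^ 2)⁻¹) * 4 ^ (normalizedFactors B).toFinset.card,
    fun M k => ?_⟩
  choose Q hQ hQ0 hQle using fun P : F[X] => exists_majorizes_eulerFactor B hα P hr0 hr1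
  have h := (majorizes_prod (s := primesUpTo F M) fun P _ => hQ P).norm_coeff_mul_pow_le hr0 k
  rw [inv_pow, ← div_eq_mul_inv, div_le_iff₀ (by positivity)] at h
  refine h.trans (mul_le_mul_of_nonneg_right ?_ (by positivity))
  rw [eval_prod]
  refine (prod_le_prod (fun P _ => hQ0 P) fun P _ => hQle P).trans ?_
  rw [prod_mul_distrib, ← Real.exp_sum, ← mul_sum, ← prod_filter, prod_const]
  refine mul_le_mul ?_ ?_ (by positivity) (by positivity)
  · refine Real.exp_le_exp.2 (mul_le_mul_of_nonneg_left ?_ (by norm_num))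
    refine sum_primesUpTo_pow_le (by positivity) ?_ M
    rw [inv_pow, ← div_eq_mul_inv, div_lt_one (by positivity)]
    exact hqρ
  · exact pow_le_pow_right₀ (by norm_num) (card_primesUpTo_filter_dvd_le hB M)

omit [Fintype F] in
open Classical in
theorem exists_eval_eulerFactor_eq (B P : F[X]) {x : ℝ} (hx : 0 ≤ x)
    (hx2 : x ^ P.natDegree ≤ 1 / 2) : ∃ v : ℝ, (eulerFactor B 1 P).eval (x : ℂ) = v ∧
      Real.exp (-6 * (x ^ 2) ^ P.natDegree) * (if P ∣ B then 1 / 4 else 1) ≤ v := by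
  set d := P.natDegree with hd
  have hy : 0 ≤ x ^ d := by positivity
  have hx2' : (x ^ 2) ^ d = (x ^ d) ^ 2 := by rw [← pow_mul, ← pow_mul, mul_comm]
  refine ⟨(1 - x ^ d) * (1 - x ^ d) * if P ∣ B then 1 else 1 + 2 * x ^ d, ?_, ?_⟩
  · rw [eulerFactor, ← hd]
    split_ifs <;> norm_num
  · rw [hx2', neg_mul, Real.exp_neg]
    set y := x ^ d
    have h1 := Real.add_one_le_exp (6 * y ^ 2)
    split_ifs
    · have : (Real.exp (6 * y ^ 2))⁻¹ ≤ 1 := inv_le_one_of_one_le₀ (Real.one_le_exp (by positivity))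
      nlinarith
    · rw [mul_one]
      refine (inv_anti₀ (by positivity) h1).trans ?_
      rw [inv_le_iff_one_le_mul₀ (by positivity)]
      have : 0 ≤ 3 + 2 * y - 18 * y ^ 2 + 12 * y ^ 3 := by
        nlinarith [mul_nonneg hy (sub_nonneg.2 hx2)]
      nlinarith [mul_nonneg (sq_nonneg y) this]

theorem exists_pos_le_re_eval_eulerProduct {B : F[X]} (hB : B ≠ 0) :
    ∃ c : ℝ, 0 < c ∧ ∀ M, c ≤ ((eulerProduct B 1 M).eval ((Fintype.card F : ℂ)⁻¹)).re := by
  classical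
  set q : ℝ := (Fintype.card F : ℝ) with hq
  have hq2 : 2 ≤ q := by
    rw [hq]
    exact_mod_cast Fintype.one_lt_card (α := F)
  have hqi : q⁻¹ ≤ 1 / 2 := by rw [one_div]; exact inv_anti₀ (by norm_num) hq2
  have hqi0 : 0 ≤ q⁻¹ := by positivity
  refine ⟨Real.exp (-6 * (1 - q * q⁻¹ ^ 2)⁻¹) * (1 / 4) ^ (normalizedFactors B).toFinset.card,
    by positivity, fun M => ?_⟩
  have hval : ∀ P ∈ primesUpTo F M, ∃ v : ℝ, (eulerFactor B 1 P).eval ((q⁻¹ : ℝ) : ℂ) = v ∧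
      Real.exp (-6 * (q⁻¹ ^ 2) ^ P.natDegree) * (if P ∣ B then 1 / 4 else 1) ≤ v := fun P hP =>
    exists_eval_eulerFactor_eq B P hqi0 <| (pow_le_of_le_one hqi0 (by linarith)
      (mem_primesUpTo.1 hP).2.1.natDegree_pos.ne').trans hqi
  choose! v hv hvle using hval
  have hcast : ((Fintype.card F : ℂ)⁻¹) = ((q⁻¹ : ℝ) : ℂ) := by simp [hq]
  rw [hcast, eulerProduct, eval_prod, prod_congr rfl hv, ← Complex.ofReal_prod, Complex.ofReal_re]
  refine le_trans ?_ (prod_le_prod (fun P _ => by positivity) hvle)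
  rw [prod_mul_distrib, ← Real.exp_sum, ← mul_sum, ← prod_filter, prod_const]
  refine mul_le_mul ?_ ?_ (by positivity) (by positivity)
  · refine Real.exp_le_exp.2 (mul_le_mul_of_nonpos_left ?_ (by norm_num))
    refine sum_primesUpTo_pow_le (by positivity) ?_ M
    rw [sq, ← mul_assoc, mul_inv_cancel₀ (by positivity)]
    linarith
  · exact pow_le_pow_of_le_one (by norm_num) (by norm_num) (card_primesUpTo_filter_dvd_le hB M)

variable [DecidableEq F]

/-- The generating series of the twisted counts divided by two twisted zeta functions. -/
noncomputable def reducedSeries (B : F[X]) (α : ℂ) : PowerSeries ℂ :=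
  PowerSeries.mk (twistedCount B α) *
    ((1 - PowerSeries.C (Fintype.card F * α) * PowerSeries.X) *
      (1 - PowerSeries.C (Fintype.card F * α ^ 2) * PowerSeries.X))

omit [DecidableEq F] in
theorem X_pow_dvd_twisted_prod_primesUpTo_sub (α : ℂ) (M : ℕ) :
    (PowerSeries.X : PowerSeries ℂ) ^ (M + 1) ∣
      ((∏ P ∈ primesUpTo F M, (1 - C (α ^ P.natDegree) * X ^ P.natDegree) : ℂ[X]) :
        PowerSeries ℂ) - (1 - PowerSeries.C (Fintype.card F * α) * PowerSeries.X) := by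
  have h := X_pow_dvd_prod_primesUpTo_sub (F := F) M
  have h' := map_dvd (PowerSeries.rescale α) h
  rw [map_pow, PowerSeries.rescale_X, mul_pow] at h'
  convert (dvd_mul_left _ _).trans h' using 1
  rw [← Polynomial.coeToPowerSeries.ringHom_apply, map_prod, map_sub, map_prod]
  simp only [map_sub, map_one, map_mul, map_pow, coeToPowerSeries.ringHom_apply, coe_C, coe_X,
    PowerSeries.rescale_X, mul_pow]
  have hC : ∀ c : ℂ, PowerSeries.rescale α (PowerSeries.C c) = PowerSeries.C c := fun c => by
    ext n
    rw [PowerSeries.coeff_rescale, PowerSeries.coeff_C]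
    split_ifs with hn <;> simp [hn]
  rw [hC, map_natCast]
  ring

theorem coeff_reducedSeries (B : F[X]) (α : ℂ) {k M : ℕ} (hk : k ≤ M) :
    PowerSeries.coeff k (reducedSeries B α) = (eulerProduct B α M).coeff k := by
  classical
  set A : ℂ[X] := ∏ P ∈ primesUpToCoprime B M,
      (1 + C (α ^ P.natDegree + (α ^ 2) ^ P.natDegree) * X ^ P.natDegree) with hA
  set E : ℂ → ℂ[X] := fun β =>
    ∏ P ∈ primesUpTo F M, (1 - C (β ^ P.natDegree) * X ^ P.natDegree) with hE
  have hH : eulerProduct B α M = A * (E α * E (α ^ 2)) := by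
    have hA' : A = ∏ P ∈ primesUpTo F M, if P ∣ B then 1 else
        1 + C (α ^ P.natDegree + (α ^ 2) ^ P.natDegree) * X ^ P.natDegree := by
      rw [hA, primesUpToCoprime, prod_filter]
      refine prod_congr rfl fun P _ => ?_
      split_ifs <;> tauto
    rw [eulerProduct, hA', hE, mul_comm, ← prod_mul_distrib, ← prod_mul_distrib]
    refine prod_congr rfl fun P _ => ?_
    rw [eulerFactor]
  have hdA : (PowerSeries.X : PowerSeries ℂ) ^ (M + 1) ∣
      PowerSeries.mk (twistedCount B α) - (A : PowerSeries ℂ) := by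
    rw [PowerSeries.X_pow_dvd_iff]
    intro m hm
    rw [map_sub, PowerSeries.coeff_mk, coeff_coe,
      twistedCount_eq_coeff B α (Nat.lt_succ_iff.1 hm), sub_self]
  have h1 := X_pow_dvd_twisted_prod_primesUpTo_sub (F := F) α M
  have h2 := X_pow_dvd_twisted_prod_primesUpTo_sub (F := F) (α ^ 2) M
  have h : (PowerSeries.X : PowerSeries ℂ) ^ (M + 1) ∣
      reducedSeries B α - (eulerProduct B α M : PowerSeries ℂ) := by
    rw [hH, Polynomial.coe_mul, Polynomial.coe_mul, reducedSeries]
    refine dvd_mul_sub_mul hdA ?_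
    rw [dvd_sub_comm]
    exact dvd_mul_sub_mul h1 h2
  have := PowerSeries.X_pow_dvd_iff.1 h k (Nat.lt_succ_iff.2 hk)
  rwa [map_sub, coeff_coe, sub_eq_zero] at this

end EulerProduct

section Asymptotics

open Filter Topology

/-- A primitive cube root of unity. -/
noncomputable def cubeRoot : ℂ := ⟨-1 / 2, √3 / 2⟩

theorem cubeRoot_sq : cubeRoot ^ 2 = ⟨-1 / 2, -(√3 / 2)⟩ := by
  have h := Real.mul_self_sqrt (show (0 : ℝ) ≤ 3 by norm_num)
  rw [sq]
  apply Complex.ext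
  · simp only [cubeRoot, Complex.mul_re]
    linarith
  · simp only [cubeRoot, Complex.mul_im]
    ring

theorem cubeRoot_add_sq : cubeRoot + cubeRoot ^ 2 = -1 := by
  rw [cubeRoot_sq]
  apply Complex.ext <;> simp [cubeRoot]

theorem cubeRoot_cube : cubeRoot ^ 3 = 1 := by
  linear_combination (cubeRoot - 1) * cubeRoot_add_sq

theorem one_add_two_mul_re_cubeRoot_pow (n : ℕ) :
    1 + 2 * (cubeRoot ^ n).re = if 3 ∣ n then 3 else 0 := by
  have hpow : cubeRoot ^ n = cubeRoot ^ (n % 3) := by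
    conv_lhs => rw [← Nat.div_add_mod n 3, pow_add, pow_mul, cubeRoot_cube, one_pow, one_mul]
  have hlt := Nat.mod_lt n (show 3 > 0 by norm_num)
  simp only [hpow, Nat.dvd_iff_mod_eq_zero]
  interval_cases n % 3
  · norm_num
  · norm_num [cubeRoot]
  · rw [cubeRoot_sq]; norm_num

theorem three_mul_ncard_cubicTwistFamily {F : Type*} [Field F] [Fintype F] [DecidableEq F]
    (B : F[X]) (N : ℕ) :
    3 * ((cubicTwistFamily B N).ncard : ℝ) =
      (twistedCount B 1 N + 2 * twistedCount B cubeRoot N).re := by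
  have h : cubicTwistFamily B N =
      ↑((finite_cubeFreeFamily B N).toFinset.filter fun D => 3 ∣ D.natDegree) := by
    ext D
    simp only [cubicTwistFamily, coe_filter, Set.Finite.mem_toFinset, cubeFreeFamily,
      Set.mem_ofPred_eq]
    tauto
  rw [h, Set.ncard_coe_finset, card_filter, twistedCount, twistedCount, mul_sum, ← sum_add_distrib,
    Complex.re_sum, Nat.cast_sum, mul_sum]
  refine sum_congr rfl fun D _ => ?_
  have := one_add_two_mul_re_cubeRoot_pow D.natDegree
  simp only [one_pow, Complex.add_re, Complex.one_re, Complex.mul_re, Complex.re_ofNat,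
    Complex.im_ofNat, zero_mul, sub_zero, this]
  split_ifs <;> simp

/-- The coefficients of `1 / (1 + X + X ^ 2)`. -/
def periodicWeight (n : ℕ) : ℂ :=
  if n % 3 = 0 then 1 else if n % 3 = 1 then -1 else 0

theorem periodicWeight_add_two (n : ℕ) :
    periodicWeight (n + 2) = -periodicWeight (n + 1) - periodicWeight n := by
  rw [periodicWeight, periodicWeight, periodicWeight, Nat.add_mod n 2, Nat.add_mod n 1]
  have := Nat.mod_lt n (show 3 > 0 by norm_num)
  interval_cases n % 3 <;> norm_num

theorem periodicWeight_congr {m n : ℕ} (h : m % 3 = n % 3) :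
    periodicWeight m = periodicWeight n := by
  rw [periodicWeight, periodicWeight, h]

theorem norm_periodicWeight_le (n : ℕ) : ‖periodicWeight n‖ ≤ 1 := by
  rw [periodicWeight]
  split_ifs <;> simp

theorem mk_recurrence_mul_eq_one (q α : ℂ) (s : ℕ → ℂ) (h0 : s 0 = 1) (h1 : s 1 = α + α ^ 2)
    (h : ∀ n, s (n + 2) = (α + α ^ 2) * s (n + 1) - α ^ 3 * s n) :
    PowerSeries.mk (fun n => s n * q ^ n) * ((1 - PowerSeries.C (q * α) * PowerSeries.X) *
      (1 - PowerSeries.C (q * α ^ 2) * PowerSeries.X)) = 1 := by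
  have hexp : (1 - PowerSeries.C (q * α) * PowerSeries.X) *
      (1 - PowerSeries.C (q * α ^ 2) * PowerSeries.X) =
      1 - PowerSeries.C (q * (α + α ^ 2)) * PowerSeries.X +
        PowerSeries.C (q ^ 2 * α ^ 3) * PowerSeries.X * PowerSeries.X := by
    simp only [map_mul, map_add, map_pow]
    ring
  generalize hc : q * (α + α ^ 2) = c at hexp
  generalize hd : q ^ 2 * α ^ 3 = d at hexp
  rw [hexp]
  ext n
  rw [mul_add, mul_sub, mul_one, ← mul_assoc, ← mul_assoc, ← mul_assoc, map_add, map_sub,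
    mul_comm _ (PowerSeries.C c), mul_comm _ (PowerSeries.C d)]
  rcases n with _ | _ | n
  · simp [h0]
  · simp [PowerSeries.coeff_succ_mul_X, PowerSeries.coeff_one, h0, h1, ← hc]
    ring
  · simp [PowerSeries.coeff_succ_mul_X, PowerSeries.coeff_one, h]
    rw [← hc, ← hd]
    ring

theorem twistedCount_eq_sum {F : Type*} [Field F] [Fintype F] [DecidableEq F] (B : F[X]) (α : ℂ)
    (s : ℕ → ℂ) (h0 : s 0 = 1) (h1 : s 1 = α + α ^ 2)
    (h : ∀ n, s (n + 2) = (α + α ^ 2) * s (n + 1) - α ^ 3 * s n) (N : ℕ) :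
    twistedCount B α N = (Fintype.card F : ℂ) ^ N * ∑ k ∈ range (N + 1),
      PowerSeries.coeff k (reducedSeries B α) * (Fintype.card F : ℂ)⁻¹ ^ k * s (N - k) := by
  set q : ℂ := (Fintype.card F : ℂ) with hq
  have hq0 : q ≠ 0 := by simp [hq]
  have hA : PowerSeries.mk (twistedCount B α) =
      reducedSeries B α * PowerSeries.mk (fun n => s n * q ^ n) := by
    rw [reducedSeries, mul_assoc, mul_comm (_ * _) (PowerSeries.mk fun n => s n * q ^ n),
      mk_recurrence_mul_eq_one q α s h0 h1 h, mul_one]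
  have := congrArg (PowerSeries.coeff N) hA
  rw [PowerSeries.coeff_mk, PowerSeries.coeff_mul,
    Finset.Nat.sum_antidiagonal_eq_sum_range_succ_mk] at this
  rw [this, mul_sum]
  refine sum_congr rfl fun k hk => ?_
  rw [PowerSeries.coeff_mk, inv_pow]
  have hk' : k ≤ N := Nat.lt_succ_iff.1 (mem_range.1 hk)
  rw [← Nat.sub_add_cancel hk', pow_add, Nat.sub_add_cancel hk']
  field_simp

/-- The sequence grows no faster than powers of every `ρ > √q`. -/
def SubSqrtGrowth (q : ℝ) (h : ℕ → ℂ) : Prop :=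
  ∀ ρ : ℝ, 1 ≤ ρ → q < ρ ^ 2 → ∃ K, ∀ k, ‖h k‖ ≤ K * ρ ^ k

theorem SubSqrtGrowth.summable {q : ℝ} (hq : 1 ≤ q) {h : ℕ → ℂ} (hh : SubSqrtGrowth q h) {ρ : ℝ}
    (hρ : 1 ≤ ρ) (hqρ : q < ρ ^ 2) : Summable fun k : ℕ => ‖h k‖ * (k + 1) * ρ⁻¹ ^ k := by
  have hlt : √q < ρ := (Real.sqrt_lt' (by linarith)).2 hqρ
  obtain ⟨σ, hσ, hσρ⟩ := exists_between hlt
  have hσ1 : 1 ≤ σ := (Real.one_le_sqrt.2 hq).trans hσ.le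
  obtain ⟨K, hK⟩ := hh σ hσ1 ((Real.sqrt_lt' (by linarith)).1 hσ)
  have hx : ‖σ / ρ‖ < 1 := by
    rw [Real.norm_of_nonneg (by positivity), div_lt_one (by linarith)]
    exact hσρ
  have hs : Summable fun k : ℕ => K * (((k : ℝ) ^ 1 * (σ / ρ) ^ k) + (σ / ρ) ^ k) :=
    ((summable_pow_mul_geometric_of_norm_lt_one 1 hx).add
      (summable_geometric_of_norm_lt_one hx)).mul_left K
  refine Summable.of_nonneg_of_le (fun k => by positivity) (fun k => ?_) hs
  calc ‖h k‖ * (k + 1) * ρ⁻¹ ^ k ≤ (K * σ ^ k) * (k + 1) * ρ⁻¹ ^ k := by gcongr; exact hK k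
    _ = _ := by rw [div_pow, inv_pow]; ring

theorem rpow_half_add_bounds {q ε : ℝ} (hq : 1 < q) (hε : 0 < ε) :
    1 ≤ q ^ (1 / 2 + ε) ∧ q < (q ^ (1 / 2 + ε)) ^ 2 := by
  refine ⟨Real.one_le_rpow hq.le (by positivity), ?_⟩
  rw [← Real.rpow_natCast, ← Real.rpow_mul (by linarith)]
  conv_lhs => rw [← Real.rpow_one q]
  exact Real.rpow_lt_rpow_of_exponent_lt hq (by push_cast; linarith)

theorem tail_sum_le {q ρ : ℝ} (hρ : 1 ≤ ρ) (hρq : ρ ≤ q) {t : ℕ → ℂ} {g : ℕ → ℝ}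
    (hg : ∀ k, 0 ≤ g k) (hgs : Summable fun k => g k * ρ⁻¹ ^ k) (ht : Summable t) {N : ℕ}
    (htg : ∀ k, N < k → ‖t k‖ ≤ g k * q⁻¹ ^ k) :
    q ^ N * ‖∑ k ∈ range (N + 1), t k - ∑' k, t k‖ ≤ ρ ^ N * ∑' k, g k * ρ⁻¹ ^ k := by
  have hρ0 : 0 < ρ := by linarith
  have hq0 : 0 < q := by linarith
  have hle : ρ / q ≤ 1 := (div_le_one hq0).2 hρq
  have hb : ∀ k, N < k → ‖t k‖ ≤ (ρ / q) ^ N * (g k * ρ⁻¹ ^ k) := fun k hk => by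
    refine (htg k hk).trans ?_
    have : q⁻¹ ^ k = (ρ / q) ^ k * ρ⁻¹ ^ k := by
      rw [← mul_pow]; congr 1; field_simp
    rw [this, mul_left_comm]
    exact mul_le_mul_of_nonneg_right (pow_le_pow_of_le_one (by positivity) hle hk.le)
      (mul_nonneg (hg k) (by positivity))
  have hshift := (summable_nat_add_iff (N + 1)).2 hgs
  have hnorm : ‖∑ k ∈ range (N + 1), t k - ∑' k, t k‖ ≤
      (ρ / q) ^ N * ∑' k, g k * ρ⁻¹ ^ k := by
    rw [← ht.sum_add_tsum_nat_add (N + 1), sub_add_cancel_left, norm_neg]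
    refine (tsum_of_norm_bounded (hshift.mul_left ((ρ / q) ^ N)).hasSum
      fun k => hb _ (by omega)).trans ?_
    rw [tsum_mul_left]
    refine mul_le_mul_of_nonneg_left ?_ (by positivity)
    rw [← hgs.sum_add_tsum_nat_add (N + 1)]
    exact le_add_of_nonneg_left (sum_nonneg fun k _ => mul_nonneg (hg k) (by positivity))
  calc q ^ N * ‖∑ k ∈ range (N + 1), t k - ∑' k, t k‖
      ≤ q ^ N * ((ρ / q) ^ N * ∑' k, g k * ρ⁻¹ ^ k) := by gcongr
    _ = ρ ^ N * ∑' k, g k * ρ⁻¹ ^ k := by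
        rw [← mul_assoc, ← mul_pow, mul_div_cancel₀ _ hq0.ne']

theorem exists_main_term {q : ℝ} (hq : 1 < q) {h₀ h₁ : ℕ → ℂ} (hh₀ : SubSqrtGrowth q h₀)
    (hh₁ : SubSqrtGrowth q h₁) {f : ℕ → ℝ}
    (hf : ∀ N, 3 * f N = ((q : ℂ) ^ N *
      (∑ k ∈ range (N + 1), h₀ k * (q : ℂ)⁻¹ ^ k * ((N - k : ℕ) + 1) +
        2 * ∑ k ∈ range (N + 1), h₁ k * (q : ℂ)⁻¹ ^ k * periodicWeight (N - k))).re) :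
    ∃ b : Fin 3 → ℝ, ∀ ε : ℝ, 0 < ε → ∃ C : ℝ, ∀ N : ℕ,
      |f N - ((∑' k, h₀ k * (q : ℂ)⁻¹ ^ k).re / 3 * N + b ⟨N % 3, Nat.mod_lt N (by norm_num)⟩)
        * q ^ N| ≤ C * q ^ ((1 / 2 + ε) * N) := by
  have hq0 : 0 < q := by linarith
  set g : ℕ → ℝ := fun k => ‖h₀ k‖ * (k + 1) + 2 * (‖h₁ k‖ * (k + 1)) with hg
  have hg0 : ∀ k, 0 ≤ g k := fun k => by positivity
  have hgs : ∀ ρ, 1 ≤ ρ → q < ρ ^ 2 → Summable fun k => g k * ρ⁻¹ ^ k := fun ρ h1 h2 => by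
    refine ((hh₀.summable hq.le h1 h2).add ((hh₁.summable hq.le h1 h2).mul_left 2)).congr
      fun k => ?_
    simp only [hg]
    ring
  have hgq : Summable fun k => g k * q⁻¹ ^ k := hgs q hq.le (by nlinarith)
  have hnq : ∀ k, ‖(q : ℂ)⁻¹ ^ k‖ = q⁻¹ ^ k := fun k => by
    rw [norm_pow, norm_inv, Complex.norm_real, Real.norm_of_nonneg hq0.le]
  have hqk : ∀ k, 0 ≤ q⁻¹ ^ k := fun k => by positivity
  have hdom : ∀ u : ℕ → ℂ, (∀ k, ‖u k‖ ≤ g k) → Summable fun k => u k * (q : ℂ)⁻¹ ^ k :=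
    fun u hu => Summable.of_norm_bounded hgq fun k => by
      rw [norm_mul, hnq]
      exact mul_le_mul_of_nonneg_right (hu k) (hqk k)
  have hsH : Summable fun k => h₀ k * (q : ℂ)⁻¹ ^ k := hdom _ fun k => by
    have : 0 ≤ ‖h₀ k‖ * k := by positivity
    have : 0 ≤ ‖h₁ k‖ * (k + 1) := by positivity
    simp only [hg]
    linarith
  have hsK : Summable fun k => (h₀ k * k) * (q : ℂ)⁻¹ ^ k := hdom _ fun k => by
    have : 0 ≤ ‖h₁ k‖ * (k + 1) := by positivity
    rw [norm_mul, Complex.norm_natCast]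
    simp only [hg]
    linarith [norm_nonneg (h₀ k)]
  have hsL : ∀ n, Summable fun k => (h₁ k * periodicWeight (n + 2 * k)) * (q : ℂ)⁻¹ ^ k :=
    fun n => hdom _ fun k => by
      have h1 : 0 ≤ ‖h₀ k‖ * (k + 1) := by positivity
      have h2 : 0 ≤ ‖h₁ k‖ * k := by positivity
      have h3 := mul_le_mul_of_nonneg_left (norm_periodicWeight_le (n + 2 * k)) (norm_nonneg (h₁ k))
      rw [norm_mul]
      simp only [hg]
      linarith [norm_nonneg (h₁ k)]
  set H := ∑' k, h₀ k * (q : ℂ)⁻¹ ^ k with hH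
  set K := ∑' k, (h₀ k * k) * (q : ℂ)⁻¹ ^ k with hK
  set L : ℕ → ℂ := fun n => ∑' k, (h₁ k * periodicWeight (n + 2 * k)) * (q : ℂ)⁻¹ ^ k with hL
  set t : ℕ → ℕ → ℂ := fun N k => (N + 1) * (h₀ k * (q : ℂ)⁻¹ ^ k) - (h₀ k * k) * (q : ℂ)⁻¹ ^ k +
    2 * ((h₁ k * periodicWeight (N + 2 * k)) * (q : ℂ)⁻¹ ^ k) with ht
  have hts : ∀ N : ℕ, HasSum (t N) ((N + 1) * H - K + 2 * L N) := fun N =>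
    ((hsH.hasSum.mul_left _).sub hsK.hasSum).add ((hsL N).hasSum.mul_left 2)
  have hLmod : ∀ N, L N = L (N % 3) := fun N => by
    refine tsum_congr fun k => ?_
    rw [periodicWeight_congr (n := N % 3 + 2 * k) (by omega)]
  have htg : ∀ N k, N < k → ‖t N k‖ ≤ g k * q⁻¹ ^ k := fun N k hk => by
    have : t N k = (h₀ k * -((k - N - 1 : ℕ) : ℂ) + 2 * (h₁ k * periodicWeight (N + 2 * k))) *
        (q : ℂ)⁻¹ ^ k := by
      obtain ⟨m, rfl⟩ := Nat.exists_eq_add_of_lt hk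
      have : N + m + 1 - N - 1 = m := by omega
      simp only [ht, this]
      push_cast
      ring
    rw [this, norm_mul, hnq]
    refine mul_le_mul_of_nonneg_right ((norm_add_le _ _).trans ?_) (hqk k)
    rw [norm_mul, norm_mul, norm_mul, norm_neg, Complex.norm_natCast, Complex.norm_ofNat]
    have h1 : ((k - N - 1 : ℕ) : ℝ) ≤ k + 1 := by
      have : k - N - 1 ≤ k + 1 := by omega
      exact_mod_cast this
    have h2 : ‖periodicWeight (N + 2 * k)‖ ≤ k + 1 :=
      (norm_periodicWeight_le _).trans (by linarith [Nat.cast_nonneg (α := ℝ) k])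
    simp only [hg]
    gcongr
  have hft : ∀ N, 3 * f N = ((q : ℂ) ^ N * ∑ k ∈ range (N + 1), t N k).re := fun N => by
    rw [hf, mul_sum, ← sum_add_distrib]
    congr 2
    refine sum_congr rfl fun k hk => ?_
    have hk' : k ≤ N := Nat.lt_succ_iff.1 (mem_range.1 hk)
    rw [periodicWeight_congr (m := N - k) (n := N + 2 * k) (by omega), Nat.cast_sub hk']
    simp only [ht]
    ring
  refine ⟨fun i => (H - K + 2 * L i).re / 3, fun ε hε => ?_⟩
  set δ := min ε (1 / 2)
  have hδ : 0 < δ := lt_min hε (by norm_num)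
  set ρ := q ^ (1 / 2 + δ)
  obtain ⟨hρ1, hρ2⟩ := rpow_half_add_bounds hq hδ
  have hρq : ρ ≤ q := by
    conv_rhs => rw [← Real.rpow_one q]
    exact Real.rpow_le_rpow_of_exponent_le hq.le (by linarith [min_le_right ε (1 / 2)])
  have hC : 0 ≤ ∑' k, g k * ρ⁻¹ ^ k := tsum_nonneg fun k => mul_nonneg (hg0 k) (by positivity)
  refine ⟨∑' k, g k * ρ⁻¹ ^ k, fun N => ?_⟩
  have htail := tail_sum_le hρ1 hρq hg0 (hgs ρ hρ1 hρ2) (hts N).summable (htg N)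
  rw [(hts N).tsum_eq, hLmod] at htail
  have hdiff : 3 * (f N - (H.re / 3 * N + (H - K + 2 * L (N % 3)).re / 3) * q ^ N) =
      ((q : ℂ) ^ N * (∑ k ∈ range (N + 1), t N k - ((N + 1) * H - K + 2 * L (N % 3)))).re := by
    conv_rhs => rw [mul_sub, Complex.sub_re, ← hft, ← Complex.ofReal_pow, Complex.re_ofReal_mul]
    simp only [Complex.add_re, Complex.sub_re, Complex.mul_re, Complex.natCast_re,
      Complex.natCast_im, Complex.add_im, Complex.one_re, Complex.one_im, Complex.re_ofNat,
      Complex.im_ofNat]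
    ring
  have hre := Complex.abs_re_le_norm
    ((q : ℂ) ^ N * (∑ k ∈ range (N + 1), t N k - ((N + 1) * H - K + 2 * L (N % 3))))
  rw [← hdiff, abs_mul, norm_mul, norm_pow, Complex.norm_real, Real.norm_of_nonneg hq0.le,
    abs_of_pos (by norm_num : (0 : ℝ) < 3)] at hre
  have hpow : ρ ^ N ≤ q ^ ((1 / 2 + ε) * N) := by
    rw [← Real.rpow_natCast, ← Real.rpow_mul hq0.le]
    refine Real.rpow_le_rpow_of_exponent_le hq.le ?_
    gcongr
    exact min_le_left _ _
  have := mul_le_mul_of_nonneg_left hpow hC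
  have := abs_nonneg (f N - (H.re / 3 * N + (H - K + 2 * L (N % 3)).re / 3) * q ^ N)
  simp only
  linarith

theorem tendsto_div_of_abs_sub_le {q a : ℝ} (hq : 1 < q) (ha : 0 < a) {f : ℕ → ℝ} {b : Fin 3 → ℝ}
    {C : ℝ}
    (h : ∀ N : ℕ, |f N - (a * N + b ⟨N % 3, Nat.mod_lt N (by norm_num)⟩) * q ^ N| ≤
      C * q ^ ((1 / 2 + 1 / 2 : ℝ) * N)) :
    Tendsto (fun N : ℕ => f N / (a * N * q ^ N)) atTop (𝓝 1) := by
  have hlim : Tendsto (fun N : ℕ => ((∑ i, |b i|) + C) / a / (N : ℝ)) atTop (𝓝 0) :=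
    tendsto_const_div_atTop_nhds_zero_nat _
  rw [tendsto_iff_norm_sub_tendsto_zero]
  refine squeeze_zero' (Eventually.of_forall fun _ => norm_nonneg _) ?_ hlim
  filter_upwards [eventually_ge_atTop 1] with N hN
  have hN0 : (0 : ℝ) < N := by exact_mod_cast hN
  have hqN : 0 < q ^ N := by positivity
  set i : Fin 3 := ⟨N % 3, Nat.mod_lt N (by norm_num)⟩ with hi
  have hbi : |b i| ≤ ∑ i, |b i| :=
    single_le_sum (f := fun i => |b i|) (fun _ _ => abs_nonneg _) (mem_univ i)
  have hN' := h N
  rw [add_halves, one_mul, Real.rpow_natCast, ← hi] at hN'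
  have hkey : |f N - a * N * q ^ N| ≤ ((∑ i, |b i|) + C) * q ^ N := by
    have : f N - a * N * q ^ N = (f N - (a * N + b i) * q ^ N) + b i * q ^ N := by ring
    rw [this]
    refine (abs_add_le _ _).trans ?_
    rw [abs_mul, abs_of_pos hqN]
    nlinarith
  rw [Real.norm_eq_abs, div_sub_one (by positivity), abs_div,
    abs_of_pos (by positivity : 0 < a * N * q ^ N), div_le_iff₀ (by positivity)]
  refine hkey.trans (le_of_eq ?_)
  field_simp

theorem subSqrtGrowth_coeff_reducedSeries {F : Type*} [Field F] [Fintype F] [DecidableEq F]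
    {B : F[X]} (hB : B ≠ 0) {α : ℂ} (hα : α ^ 3 = 1) :
    SubSqrtGrowth (Fintype.card F) fun k => PowerSeries.coeff k (reducedSeries B α) :=
  fun _ hρ hqρ =>
    let ⟨K, hK⟩ := exists_norm_coeff_eulerProduct_le hB hα hρ hqρ
    ⟨K, fun k => by simpa only [coeff_reducedSeries B α le_rfl] using hK k k⟩

theorem re_tsum_coeff_reducedSeries_pos {F : Type*} [Field F] [Fintype F] [DecidableEq F]
    {B : F[X]} (hB : B ≠ 0) :
    0 < (∑' k, PowerSeries.coeff k (reducedSeries B 1) * (Fintype.card F : ℂ)⁻¹ ^ k).re := by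
  obtain ⟨c, hc, hle⟩ := exists_pos_le_re_eval_eulerProduct hB
  set q : ℝ := (Fintype.card F : ℝ) with hqdef
  have hq : 1 < q := by
    rw [hqdef]
    exact_mod_cast Fintype.one_lt_card (α := F)
  obtain ⟨ρ, hρ, hρq⟩ : ∃ ρ, √q < ρ ∧ ρ < q :=
    exists_between ((Real.sqrt_lt' (by linarith)).2 (by nlinarith))
  have hρ1 : 1 ≤ ρ := (Real.one_le_sqrt.2 hq.le).trans hρ.le
  obtain ⟨K, hK⟩ := exists_norm_coeff_eulerProduct_le hB (one_pow 3) hρ1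
    ((Real.sqrt_lt' (by linarith)).1 hρ)
  have hlim : Tendsto (fun M => ∑' k, (eulerProduct B 1 M).coeff k * (Fintype.card F : ℂ)⁻¹ ^ k)
      atTop (𝓝 (∑' k, PowerSeries.coeff k (reducedSeries B 1) * (Fintype.card F : ℂ)⁻¹ ^ k)) := by
    refine tendsto_tsum_of_dominated_convergence (bound := fun k => K * (ρ / q) ^ k) ?_ ?_ ?_
    · exact (summable_geometric_of_lt_one (by positivity)
        ((div_lt_one (by linarith)).2 hρq)).mul_left K
    · intro k
      refine tendsto_const_nhds.congr' ?_
      filter_upwards [eventually_ge_atTop k] with M hM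
      rw [coeff_reducedSeries B 1 hM]
    · refine Eventually.of_forall fun M k => ?_
      rw [norm_mul, norm_pow, norm_inv, Complex.norm_natCast, div_pow, div_eq_mul_inv, ← mul_assoc,
        inv_pow]
      exact mul_le_mul_of_nonneg_right (hK M k) (by positivity)
  have heval : ∀ M, ∑' k, (eulerProduct B 1 M).coeff k * (Fintype.card F : ℂ)⁻¹ ^ k =
      (eulerProduct B 1 M).eval (Fintype.card F : ℂ)⁻¹ := fun M => by
    rw [eval_eq_sum_range]
    refine tsum_eq_sum fun k hk => ?_
    rw [coeff_eq_zero_of_natDegree_lt (by simpa using hk), zero_mul]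
  simp only [heval] at hlim
  exact hc.trans_le (ge_of_tendsto' ((Complex.continuous_re.tendsto _).comp hlim) hle)

end Asymptotics

end CubicFamily

/-- Corollary 4.6 of the paper: there are `a > 0` and `b₀, b₁, b₂` such that
`#F_N(B) = (a·N + b_{N mod 3})·q^N + O_ε(q^{(1/2+ε)N})` for every `ε > 0`;
in particular `#F_N(B) ∼ a·N·q^N` as `N → ∞`. -/
theorem cubic_family_count_asymptotic
    (Fq : Type*) [Field Fq] [Fintype Fq] [DecidableEq Fq]
    (B : Fq[X]) (hB : B ≠ 0) :
    ∃ a : ℝ, 0 < a ∧ ∃ b : Fin 3 → ℝ,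
      (∀ ε : ℝ, 0 < ε → ∃ C : ℝ, ∀ N : ℕ, 1 ≤ N →
        |((cubicTwistFamily B N).ncard : ℝ) -
            (a * N + b ⟨N % 3, Nat.mod_lt N (by norm_num)⟩) * (Fintype.card Fq : ℝ) ^ N| ≤
          C * (Fintype.card Fq : ℝ) ^ ((1 / 2 + ε) * N)) ∧
      Filter.Tendsto
        (fun N : ℕ => ((cubicTwistFamily B N).ncard : ℝ) /
          (a * N * (Fintype.card Fq : ℝ) ^ N))
        Filter.atTop (nhds 1) := by
  classical
  set q : ℝ := (Fintype.card Fq : ℝ) with hqdef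
  have hq : 1 < q := by
    rw [hqdef]
    exact_mod_cast Fintype.one_lt_card (α := Fq)
  have hqC : (q : ℂ) = (Fintype.card Fq : ℂ) := by simp [hqdef]
  have hf : ∀ N, 3 * ((cubicTwistFamily B N).ncard : ℝ) =
      ((q : ℂ) ^ N * (∑ k ∈ Finset.range (N + 1),
          PowerSeries.coeff k (CubicFamily.reducedSeries B 1) * (q : ℂ)⁻¹ ^ k * ((N - k : ℕ) + 1)
        + 2 * ∑ k ∈ Finset.range (N + 1),
          PowerSeries.coeff k (CubicFamily.reducedSeries B CubicFamily.cubeRoot) * (q : ℂ)⁻¹ ^ k *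
            CubicFamily.periodicWeight (N - k))).re := fun N => by
    rw [CubicFamily.three_mul_ncard_cubicTwistFamily,
      CubicFamily.twistedCount_eq_sum B 1 (fun n => (n : ℂ) + 1) (by simp) (by norm_num)
        (fun n => by push_cast; ring),
      CubicFamily.twistedCount_eq_sum B CubicFamily.cubeRoot CubicFamily.periodicWeight
        (by simp [CubicFamily.periodicWeight])
        (by rw [CubicFamily.cubeRoot_add_sq]; norm_num [CubicFamily.periodicWeight])
        (fun n => by
          rw [CubicFamily.cubeRoot_add_sq, CubicFamily.cubeRoot_cube,
            CubicFamily.periodicWeight_add_two]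
          ring), hqC]
    congr 1
    ring
  have hpos := CubicFamily.re_tsum_coeff_reducedSeries_pos hB
  rw [← hqC] at hpos
  obtain ⟨b, hb⟩ := CubicFamily.exists_main_term hq
    (CubicFamily.subSqrtGrowth_coeff_reducedSeries hB (one_pow 3))
    (CubicFamily.subSqrtGrowth_coeff_reducedSeries hB CubicFamily.cubeRoot_cube) hf
  refine ⟨_, div_pos hpos (by norm_num : (0 : ℝ) < 3), b, fun ε hε => ?_, ?_⟩
  · obtain ⟨C, hC⟩ := hb ε hε
    exact ⟨C, fun N _ => hC N⟩
  · obtain ⟨C, hC⟩ := hb (1 / 2) (by norm_num)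
    exact CubicFamily.tendsto_div_of_abs_sub_le hq (div_pos hpos (by norm_num)) hC
end

section
/- Let 𝔽_q be a finite field and let B ∈ 𝔽_q[T] be nonzero. Let P ∈ 𝔽_q[T] be monic irreducible of degree m with P ∤ B. Then for every d ≥ 0: N_d(P·B) = ∑_{a=0}^{⌊d/m⌋} (−2)^a · N_{d − a·m}(B). -/
open Polynomial UniqueFactorizationMonoid

/-- `N_d(B)`: the number of monic cube-free polynomials coprime to `B` with
`deg(rad D) = d`. -/
noncomputable def cubeFreeCount {Fq : Type*} [Field Fq] [DecidableEq Fq]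
    (B : Fq[X]) (d : ℕ) : ℕ :=
  {D : Fq[X] | D.Monic ∧ D.CubeFree ∧ IsCoprime D B ∧ D.radDeg = d}.ncard

section CubeFree

variable {Fq : Type*} [Field Fq]

theorem Polynomial.CubeFree.of_dvd {D E : Fq[X]} (hE : E.CubeFree) (h : D ∣ E) : D.CubeFree :=
  fun Q hQ hQi hdvd => hE Q hQ hQi (hdvd.trans h)

theorem Polynomial.CubeFree.prime_pow_mul {P D : Fq[X]} {k : ℕ} (hP : P.Monic)
    (hirr : Irreducible P) (hPD : ¬P ∣ D) (hk : k < 3) (hD : D.CubeFree) :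
    (P ^ k * D).CubeFree := by
  intro Q hQ hQi hdvd
  by_cases hQP : Q = P
  · subst hQP
    have h := (pow_dvd_pow Q (show k + 1 ≤ 3 by omega)).trans hdvd
    rw [pow_succ] at h
    exact hPD ((mul_dvd_mul_iff_left (pow_ne_zero k hQi.ne_zero)).1 h)
  · have hcop : IsCoprime Q P := (hQi.coprime_iff_not_dvd).2 fun h =>
      hQP (eq_of_monic_of_associated hQ hP (hQi.associated_of_dvd hirr h))
    exact hD Q hQ hQi (hcop.pow.dvd_of_dvd_mul_left hdvd)

theorem Polynomial.isCoprime_prime_mul_iff {P D : Fq[X]} (B : Fq[X]) (hirr : Irreducible P) :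
    IsCoprime D (P * B) ↔ ¬P ∣ D ∧ IsCoprime D B := by
  rw [IsCoprime.mul_right_iff, isCoprime_comm (x := D), hirr.coprime_iff_not_dvd]

variable [DecidableEq Fq]

theorem Polynomial.radDeg_prime_pow_mul {P D : Fq[X]} {k : ℕ} (hP : P.Monic)
    (hirr : Irreducible P) (hD : D ≠ 0) (hPD : ¬P ∣ D) (hk : k ≠ 0) :
    (P ^ k * D).radDeg = P.natDegree + D.radDeg := by
  have hset : (normalizedFactors (P ^ k * D)).toFinset =
      insert P (normalizedFactors D).toFinset := by
    rw [normalizedFactors_mul (pow_ne_zero k hirr.ne_zero) hD, normalizedFactors_pow,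
      normalizedFactors_irreducible hirr, hP.normalize_eq_self, Multiset.toFinset_add,
      Multiset.toFinset_nsmul _ _ hk, Multiset.toFinset_singleton, Finset.insert_eq]
  rw [radDeg, hset, Finset.sum_insert, radDeg]
  exact fun h => hPD (dvd_of_mem_normalizedFactors (Multiset.mem_toFinset.1 h))

theorem Polynomial.CubeFree.natDegree_le {D : Fq[X]} (hD0 : D ≠ 0) (hD : D.CubeFree) :
    D.natDegree ≤ 2 * D.radDeg := by
  have hdvd : D ∣ (∏ Q ∈ (normalizedFactors D).toFinset, Q) ^ 2 := by
    refine (prod_normalizedFactors hD0).symm.dvd.trans ?_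
    rw [Finset.prod_multiset_count, ← Finset.prod_pow]
    refine Finset.prod_dvd_prod_of_dvd _ _ fun Q hQ => pow_dvd_pow Q ?_
    have hQ' := Multiset.mem_toFinset.1 hQ
    by_contra! hlt
    have hQ0 : Q ≠ 0 := (irreducible_of_normalized_factor Q hQ').ne_zero
    refine hD Q ?_ (irreducible_of_normalized_factor Q hQ') ?_
    · exact normalize_normalized_factor Q hQ' ▸ monic_normalize hQ0
    · have hle := Multiset.le_count_iff_replicate_le.1 hlt
      have := (Multiset.prod_dvd_prod_of_le hle).trans (prod_normalizedFactors hD0).dvd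
      simpa only [Multiset.prod_replicate] using this
  have hne : ∀ Q ∈ (normalizedFactors D).toFinset, Q ≠ 0 := fun Q hQ =>
    (irreducible_of_normalized_factor Q (Multiset.mem_toFinset.1 hQ)).ne_zero
  have := natDegree_le_of_dvd hdvd (pow_ne_zero 2 (Finset.prod_ne_zero_iff.2 hne))
  rwa [natDegree_pow, natDegree_prod _ _ hne] at this

theorem Polynomial.finite_setOf_natDegree_le (R : Type*) [Ring R] [Finite R] (n : ℕ) :
    {p : R[X] | p.natDegree ≤ n}.Finite := by
  refine Set.Finite.of_injOn (f := fun p (i : Fin (n + 1)) => p.coeff i) (t := Set.univ)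
    (Set.mapsTo_univ _ _) (fun p hp q hq h => ?_) Set.finite_univ
  ext i
  by_cases hi : i < n + 1
  · exact congrFun h ⟨i, hi⟩
  · rw [coeff_eq_zero_of_natDegree_lt (lt_of_le_of_lt hp (by omega)),
      coeff_eq_zero_of_natDegree_lt (lt_of_le_of_lt hq (by omega))]

/-- The set counted by `cubeFreeCount B d`. -/
def cubeFreeSet (B : Fq[X]) (d : ℕ) : Set Fq[X] :=
  {D : Fq[X] | D.Monic ∧ D.CubeFree ∧ IsCoprime D B ∧ D.radDeg = d}

theorem finite_cubeFreeSet [Finite Fq] (B : Fq[X]) (d : ℕ) : (cubeFreeSet B d).Finite :=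
  (finite_setOf_natDegree_le Fq (2 * d)).subset fun _ ⟨hm, hc, _, hd⟩ =>
    hd ▸ hc.natDegree_le hm.ne_zero

theorem not_dvd_of_mem_cubeFreeSet {P B D : Fq[X]} {d : ℕ} (hirr : Irreducible P)
    (hD : D ∈ cubeFreeSet (P * B) d) : ¬P ∣ D :=
  ((isCoprime_prime_mul_iff B hirr).1 hD.2.2.1).1

theorem mem_cubeFreeSet_prime_mul_iff {P B D : Fq[X]} {d : ℕ} (hirr : Irreducible P) :
    D ∈ cubeFreeSet (P * B) d ↔ D ∈ cubeFreeSet B d ∧ ¬P ∣ D := by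
  simp only [cubeFreeSet, Set.mem_ofPred_eq, isCoprime_prime_mul_iff B hirr]
  tauto

theorem prime_pow_mul_mem_cubeFreeSet {P B D : Fq[X]} {d k : ℕ} (hP : P.Monic)
    (hirr : Irreducible P) (hPB : ¬P ∣ B) (hk : k ≠ 0) (hk3 : k < 3)
    (hD : D ∈ cubeFreeSet (P * B) d) :
    P ^ k * D ∈ cubeFreeSet B (P.natDegree + d) := by
  obtain ⟨⟨hm, hc, hcop, hd⟩, hPD⟩ := (mem_cubeFreeSet_prime_mul_iff hirr).1 hD
  refine ⟨(hP.pow k).mul hm, hc.prime_pow_mul hP hirr hPD hk3,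
    ((hirr.coprime_iff_not_dvd).2 hPB).pow_left.mul_left hcop, ?_⟩
  rw [radDeg_prime_pow_mul hP hirr hm.ne_zero hPD hk, hd]

theorem exists_eq_prime_pow_mul_of_mem_cubeFreeSet {P B E : Fq[X]} {d : ℕ} (hP : P.Monic)
    (hirr : Irreducible P) (hE : E ∈ cubeFreeSet B d) (hPE : P ∣ E) :
    ∃ k D e, (k = 1 ∨ k = 2) ∧ D ∈ cubeFreeSet (P * B) e ∧ d = P.natDegree + e ∧
      E = P ^ k * D := by
  obtain ⟨hm, hc, hcop, hd⟩ := hE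
  obtain ⟨k, D, hPD, rfl⟩ := WfDvdMonoid.max_power_factor hm.ne_zero hirr
  have hk3 : k < 3 := by
    by_contra! h
    exact hc P hP hirr ((pow_dvd_pow P h).trans (dvd_mul_right _ _))
  have hk0 : k ≠ 0 := by
    rintro rfl
    exact hPD (by simpa using hPE)
  have hDm : D.Monic := (hP.pow k).of_mul_monic_left hm
  refine ⟨k, D, D.radDeg, by omega, ?_, ?_, rfl⟩
  · exact (mem_cubeFreeSet_prime_mul_iff hirr).2
      ⟨⟨hDm, hc.of_dvd (dvd_mul_left _ _), hcop.of_mul_left_right, rfl⟩, hPD⟩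
  · rw [← hd, radDeg_prime_pow_mul hP hirr hDm.ne_zero hPD hk0]

theorem cubeFreeCount_eq_of_lt {P B : Fq[X]} {d : ℕ} (hP : P.Monic) (hirr : Irreducible P)
    (hd : d < P.natDegree) : cubeFreeCount B d = cubeFreeCount (P * B) d := by
  change (cubeFreeSet B d).ncard = (cubeFreeSet (P * B) d).ncard
  congr 1
  ext E
  rw [mem_cubeFreeSet_prime_mul_iff hirr]
  refine ⟨fun hE => ⟨hE, fun hPE => ?_⟩, And.left⟩
  obtain ⟨k, D, e, -, -, h, -⟩ := exists_eq_prime_pow_mul_of_mem_cubeFreeSet hP hirr hE hPE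
  omega

/-- The coefficientwise form of the Euler-product relation `H₀(u;B) = (1 + 2u^m) H₀(u;PB)`. -/
theorem cubeFreeCount_natDegree_add [Finite Fq] {P B : Fq[X]} (hP : P.Monic)
    (hirr : Irreducible P) (hPB : ¬P ∣ B) (d : ℕ) :
    cubeFreeCount B (P.natDegree + d) =
      cubeFreeCount (P * B) (P.natDegree + d) + 2 * cubeFreeCount (P * B) d := by
  change (cubeFreeSet B (P.natDegree + d)).ncard =
    (cubeFreeSet (P * B) (P.natDegree + d)).ncard + 2 * (cubeFreeSet (P * B) d).ncard
  have hinj (k : ℕ) : Function.Injective (P ^ k * ·) :=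
    mul_right_injective₀ (pow_ne_zero k hirr.ne_zero)
  have hunion : cubeFreeSet B (P.natDegree + d) = cubeFreeSet (P * B) (P.natDegree + d) ∪
      ((P ^ 1 * ·) '' cubeFreeSet (P * B) d ∪ (P ^ 2 * ·) '' cubeFreeSet (P * B) d) := by
    ext E
    constructor
    · intro hE
      by_cases hPE : P ∣ E
      · obtain ⟨k, D, e, hk, hD, h, rfl⟩ :=
          exists_eq_prime_pow_mul_of_mem_cubeFreeSet hP hirr hE hPE
        obtain rfl := Nat.add_left_cancel h
        rcases hk with rfl | rfl
        · exact Or.inr (Or.inl ⟨D, hD, rfl⟩)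
        · exact Or.inr (Or.inr ⟨D, hD, rfl⟩)
      · exact Or.inl ((mem_cubeFreeSet_prime_mul_iff hirr).2 ⟨hE, hPE⟩)
    · rintro (hE | ⟨D, hD, rfl⟩ | ⟨D, hD, rfl⟩)
      · exact ((mem_cubeFreeSet_prime_mul_iff hirr).1 hE).1
      · exact prime_pow_mul_mem_cubeFreeSet hP hirr hPB (by simp) (by simp) hD
      · exact prime_pow_mul_mem_cubeFreeSet hP hirr hPB (by simp) (by simp) hD
  have hdisj₁ : Disjoint (cubeFreeSet (P * B) (P.natDegree + d))
      ((P ^ 1 * ·) '' cubeFreeSet (P * B) d ∪ (P ^ 2 * ·) '' cubeFreeSet (P * B) d) := by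
    rw [Set.disjoint_left]
    rintro _ hE (⟨D, -, rfl⟩ | ⟨D, -, rfl⟩)
    · exact not_dvd_of_mem_cubeFreeSet hirr hE ((dvd_pow_self P one_ne_zero).mul_right D)
    · exact not_dvd_of_mem_cubeFreeSet hirr hE ((dvd_pow_self P two_ne_zero).mul_right D)
  have hdisj₂ : Disjoint ((P ^ 1 * ·) '' cubeFreeSet (P * B) d)
      ((P ^ 2 * ·) '' cubeFreeSet (P * B) d) := by
    rw [Set.disjoint_left]
    rintro _ ⟨D, hD, rfl⟩ ⟨D', -, h⟩
    refine not_dvd_of_mem_cubeFreeSet hirr hD ⟨D', hinj 1 ?_⟩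
    simp only at h ⊢
    rw [← h]
    ring
  have hfin := finite_cubeFreeSet (P * B) d
  rw [hunion, Set.ncard_union_eq hdisj₁ (finite_cubeFreeSet _ _)
    ((hfin.image _).union (hfin.image _)), Set.ncard_union_eq hdisj₂ (hfin.image _)
    (hfin.image _), Set.ncard_image_of_injective _ (hinj 1),
    Set.ncard_image_of_injective _ (hinj 2), two_mul]

end CubeFree

/-- The `j = 0` case of Lemma 4.7 of the paper: for a monic irreducible `P ∤ B` of
degree `m`, `N_d(PB) = ∑_{a=0}^{⌊d/m⌋} (-2)^a N_{d-am}(B)`. -/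
theorem cubefree_count_remove_prime
    (Fq : Type*) [Field Fq] [Fintype Fq] [DecidableEq Fq]
    (B : Fq[X]) (hB : B ≠ 0) (P : Fq[X]) (hP : P.Monic) (hirr : Irreducible P)
    (hPB : ¬P ∣ B) (d : ℕ) :
    (cubeFreeCount (P * B) d : ℤ) =
      ∑ a ∈ Finset.range (d / P.natDegree + 1),
        (-2 : ℤ) ^ a * (cubeFreeCount B (d - a * P.natDegree) : ℤ) := by
  have hm : 0 < P.natDegree := hirr.natDegree_pos
  induction d using Nat.strong_induction_on with
  | _ d ih =>
    rcases lt_or_ge d P.natDegree with hd | hd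
    · simp [Nat.div_eq_of_lt hd, cubeFreeCount_eq_of_lt (B := B) hP hirr hd]
    · obtain ⟨e, rfl⟩ := Nat.exists_eq_add_of_le hd
      have hstep := cubeFreeCount_natDegree_add hP hirr hPB e
      rw [Nat.add_div_left e hm, Finset.sum_range_succ']
      have hshift : ∀ a, P.natDegree + e - (a + 1) * P.natDegree = e - a * P.natDegree := by
        intro a
        rw [Nat.succ_mul]
        omega
      simp only [hshift, pow_succ', mul_assoc, ← Finset.mul_sum]
      rw [← ih e (by omega)]
      simp only [pow_zero, one_mul, zero_mul, Nat.sub_zero]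
      rw [hstep]
      push_cast
      ring
end

section
/- Let 𝔽_q be a finite field and let B ∈ 𝔽_q[T] be nonzero. For D ∈ 𝔽_q[T] and k ≥ 1 set deg(D_k) := ∑_{P ∣ D, deg(P) = k} deg(P), the sum running over the distinct monic irreducible divisors of D of degree k. Then there exists a constant C (depending on q and B) such that for all n ≥ 1 and N ≥ 1: ∑_{D ∈ F_N(B)} n · ∑_{d ∣ n} deg(D_{n/d}) ≤ C · n · τ(n) · #F_N(B), where τ(n) is the number of positive divisors of n and the inner sum runs over the positive divisors d of n. -/
open Polynomial UniqueFactorizationMonoid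

/-- `deg(D_k)`: the sum of `deg P` over the distinct monic irreducible divisors `P` of `D`
of degree `k`. -/
noncomputable def degPart {Fq : Type*} [Field Fq] [DecidableEq Fq] (D : Fq[X]) (k : ℕ) : ℕ :=
  ∑ P ∈ (normalizedFactors D).toFinset.filter (fun P => P.natDegree = k), P.natDegree

theorem sum_Icc_four_inv_pow_le {q : ℝ} (hq : 2 ≤ q) (m : ℕ) :
    ∑ d ∈ Finset.Icc 4 m, (q ^ d)⁻¹ ≤ 1 / 8 := by
  have h : ∀ m, ∑ d ∈ Finset.Icc 4 (m + 3), ((2 : ℝ) ^ d)⁻¹ ≤ 1 / 8 - ((2 : ℝ) ^ (m + 3))⁻¹ := by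
    intro m
    induction m with
    | zero => norm_num
    | succ m ih =>
      rw [show m + 1 + 3 = (m + 3) + 1 by ring, Finset.sum_Icc_succ_top (by omega)]
      have : ((2 : ℝ) ^ (m + 3 + 1))⁻¹ = ((2 : ℝ) ^ (m + 3))⁻¹ / 2 := by
        rw [pow_succ, mul_inv]; ring
      rw [this] at *
      linarith
  calc ∑ d ∈ Finset.Icc 4 m, (q ^ d)⁻¹ ≤ ∑ d ∈ Finset.Icc 4 (m + 3), (q ^ d)⁻¹ := by
        refine Finset.sum_le_sum_of_subset_of_nonneg (Finset.Icc_subset_Icc_right (by omega)) ?_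
        intros
        positivity
    _ ≤ ∑ d ∈ Finset.Icc 4 (m + 3), ((2 : ℝ) ^ d)⁻¹ := by gcongr
    _ ≤ 1 / 8 := (h m).trans (by simp)

theorem exists_forall_mul_le_pow {q : ℝ} (hq : 1 < q) (K : ℝ) :
    ∃ M : ℕ, ∀ n : ℕ, M ≤ n → 64 * (n + 1) * K ≤ q ^ (n / 2) := by
  have hK : 0 < |K| + 1 := by positivity
  have h := (tendsto_pow_const_div_const_pow_of_one_lt 1 hq).eventually_le_const
    (by positivity : 0 < 1 / (256 * (|K| + 1)))
  obtain ⟨m, hm⟩ := Filter.eventually_atTop.1 h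
  refine ⟨2 * m + 2, fun n hn => ?_⟩
  have h1 := hm (n / 2) (by omega)
  rw [pow_one, div_le_div_iff₀ (by positivity) (by positivity), one_mul] at h1
  have h2 : (n + 1 : ℝ) ≤ 4 * (n / 2 : ℕ) := by exact_mod_cast (by omega)
  have h3 : K ≤ |K| + 1 := (le_abs_self K).trans (by linarith)
  calc 64 * (n + 1) * K ≤ 64 * (n + 1) * (|K| + 1) := by gcongr
    _ ≤ 64 * (4 * (n / 2 : ℕ)) * (|K| + 1) := by gcongr
    _ = (n / 2 : ℕ) * (256 * (|K| + 1)) := by ring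
    _ ≤ q ^ (n / 2) := h1

section Factorization

variable {Fq : Type*} [Field Fq]

theorem isCoprime_of_dvd_sub_one {W D : Fq[X]} (h : W ∣ D - 1) : IsCoprime D W := by
  obtain ⟨f, hf⟩ := h
  exact ⟨1, -f, by linear_combination hf⟩

theorem four_le_natDegree_of_dvd {W D P : Fq[X]}
    (hW3 : ∀ P : Fq[X], P.Monic → P.natDegree ≤ 3 → P ∣ W) (hD : W ∣ D - 1) (hP : P.Monic)
    (hPi : Irreducible P) (hPD : P ∣ D) : 4 ≤ P.natDegree ∧ IsCoprime P W := by
  have hc : IsCoprime P W := (isCoprime_of_dvd_sub_one hD).of_isCoprime_of_dvd_left hPD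
  refine ⟨?_, hc⟩
  by_contra! h
  exact hPi.not_isUnit (hc.isUnit_of_dvd' dvd_rfl (hW3 P hP (by omega)))

variable [DecidableEq Fq]


theorem monic_of_mem_normalizedFactors {D P : Fq[X]} (h : P ∈ normalizedFactors D) : P.Monic := by
  by_cases hD : D = 0
  · simp [hD] at h
  · exact ((Polynomial.mem_normalizedFactors_iff hD).1 h).2.1

theorem normalizedFactors_mul_sq {A E : Fq[X]} (hA : A ≠ 0) (hE : E ≠ 0) :
    normalizedFactors (A * E ^ 2) = normalizedFactors A + 2 • normalizedFactors E := by
  rw [normalizedFactors_mul hA (pow_ne_zero _ hE), normalizedFactors_pow]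

theorem count_normalizedFactors_le_one {A : Fq[X]} (hA : Squarefree A) (P : Fq[X]) :
    (normalizedFactors A).count P ≤ 1 :=
  Multiset.nodup_iff_count_le_one.1
    ((squarefree_iff_nodup_normalizedFactors hA.ne_zero).1 hA) P

theorem Polynomial.Monic.prod_normalizedFactors {A : Fq[X]} (hA : A.Monic) :
    (normalizedFactors A).prod = A := by
  rw [prod_normalizedFactors_eq hA.ne_zero, hA.normalize_eq_self]

theorem mul_sq_injective {A E A' E' : Fq[X]} (hA : A.Monic) (hE : E.Monic) (hA' : A'.Monic)
    (hE' : E'.Monic) (sA : Squarefree A)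
    (sA' : Squarefree A') (h : A * E ^ 2 = A' * E' ^ 2) : A = A' ∧ E = E' := by
  have h2 := congrArg normalizedFactors h
  rw [normalizedFactors_mul_sq hA.ne_zero hE.ne_zero,
    normalizedFactors_mul_sq hA'.ne_zero hE'.ne_zero] at h2
  have key : ∀ P, (normalizedFactors A).count P = (normalizedFactors A').count P ∧
      (normalizedFactors E).count P = (normalizedFactors E').count P := by
    intro P
    have h3 := congrArg (Multiset.count P) h2
    simp only [Multiset.count_add, Multiset.count_nsmul] at h3
    have := count_normalizedFactors_le_one sA P
    have := count_normalizedFactors_le_one sA' P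
    omega
  constructor
  · rw [← hA.prod_normalizedFactors, ← hA'.prod_normalizedFactors,
      Multiset.ext.2 fun P => (key P).1]
  · rw [← hE.prod_normalizedFactors, ← hE'.prod_normalizedFactors,
      Multiset.ext.2 fun P => (key P).2]

theorem radDeg_eq_natDegree {A : Fq[X]} (hA : A.Monic) (sA : Squarefree A) :
    A.radDeg = A.natDegree := by
  conv_rhs => rw [← hA.prod_normalizedFactors]
  rw [natDegree_multiset_prod_of_monic _ fun P hP => monic_of_mem_normalizedFactors hP,
    Polynomial.radDeg, Finset.sum, Multiset.toFinset_val,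
    Multiset.dedup_eq_self.2 ((squarefree_iff_nodup_normalizedFactors hA.ne_zero).1 sA)]

theorem mul_sq_mem_cubicTwistFamily {A E B : Fq[X]} {N : ℕ} (hA : A.Monic) (hE : E.Monic)
    (sA : Squarefree A) (sE : Squarefree E) (hAE : IsCoprime A E) (hAB : IsCoprime A B)
    (hEB : IsCoprime E B) (hN : A.natDegree + E.natDegree = N)
    (h3 : 3 ∣ A.natDegree + 2 * E.natDegree) : A * E ^ 2 ∈ cubicTwistFamily B N := by
  have hdisj : ∀ P, P ∈ normalizedFactors A → P ∉ normalizedFactors E := by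
    intro P hP hP'
    exact (irreducible_of_normalized_factor P hP).not_isUnit
      (hAE.isUnit_of_dvd' (dvd_of_mem_normalizedFactors hP) (dvd_of_mem_normalizedFactors hP'))
  refine ⟨hA.mul (hE.pow 2), ?_, hAB.mul_left hEB.pow_left, ?_, ?_⟩
  · intro P hPm hPi hP
    have h := (dvd_iff_normalizedFactors_le_normalizedFactors (pow_ne_zero 3 hPm.ne_zero)
      (hA.mul (hE.pow 2)).ne_zero).1 hP
    rw [normalizedFactors_mul_sq hA.ne_zero hE.ne_zero, normalizedFactors_pow,
      normalizedFactors_irreducible hPi, hPm.normalize_eq_self] at h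
    have h := Multiset.count_le_of_le P h
    simp only [Multiset.count_add, Multiset.count_nsmul, Multiset.count_singleton_self] at h
    have h1 := count_normalizedFactors_le_one sA P
    have h2 := count_normalizedFactors_le_one sE P
    exact hdisj P (Multiset.count_pos.1 (by omega)) (Multiset.count_pos.1 (by omega))
  · rw [← hN, ← radDeg_eq_natDegree hA sA, ← radDeg_eq_natDegree hE sE]
    simp only [Polynomial.radDeg]
    rw [normalizedFactors_mul_sq hA.ne_zero hE.ne_zero, Multiset.toFinset_add,
      Multiset.toFinset_nsmul _ _ two_ne_zero, Finset.sum_union]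
    rw [Finset.disjoint_left]
    intro P
    simpa only [Multiset.mem_toFinset] using hdisj P
  · rwa [hA.natDegree_mul (hE.pow 2), hE.natDegree_pow]

theorem exists_mul_sq_eq {D : Fq[X]} (hD : D.Monic) (hc : D.CubeFree) :
    ∃ A E : Fq[X], A.Monic ∧ E.Monic ∧ D = A * E ^ 2 ∧ A.natDegree + E.natDegree = D.radDeg ∧
      ∀ P, Irreducible P → P ∣ D → P ∣ A ∨ P ∣ E := by
  set S := (normalizedFactors D).toFinset with hS
  have hm : ∀ P ∈ S, P.Monic := fun P hP =>
    monic_of_mem_normalizedFactors (Multiset.mem_toFinset.1 hP)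
  set A := ∏ P ∈ S.filter (fun P => (normalizedFactors D).count P = 1), P with hA
  set E := ∏ P ∈ S.filter (fun P => ¬ (normalizedFactors D).count P = 1), P with hE
  have hAm : A.Monic := monic_prod_of_monic _ _ fun P hP => hm P (Finset.mem_filter.1 hP).1
  have hEm : E.Monic := monic_prod_of_monic _ _ fun P hP => hm P (Finset.mem_filter.1 hP).1
  have hDA : D = A * E ^ 2 := by
    rw [← hD.prod_normalizedFactors, Finset.prod_multiset_count, ← hS,
      ← Finset.prod_filter_mul_prod_filter_not S (fun P => (normalizedFactors D).count P = 1),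
      hA, hE, ← Finset.prod_pow]
    congr 1
    · refine Finset.prod_congr rfl fun P hP => ?_
      rw [(Finset.mem_filter.1 hP).2, pow_one]
    · refine Finset.prod_congr rfl fun P hP => ?_
      obtain ⟨hPS, h1⟩ := Finset.mem_filter.1 hP
      have hpos := Multiset.count_pos.2 (Multiset.mem_toFinset.1 hPS)
      have hle : (normalizedFactors D).count P < 3 := by
        by_contra! hcon
        refine hc P (hm P hPS) (irreducible_of_normalized_factor P (Multiset.mem_toFinset.1 hPS)) ?_
        have := Multiset.prod_dvd_prod_of_le (Multiset.le_count_iff_replicate_le.1 hcon)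
        rwa [Multiset.prod_replicate, hD.prod_normalizedFactors] at this
      rw [show (normalizedFactors D).count P = 2 by omega]
  refine ⟨A, E, hAm, hEm, hDA, ?_, ?_⟩
  · rw [hA, hE, natDegree_prod_of_monic _ _ fun P hP => hm P (Finset.mem_filter.1 hP).1,
      natDegree_prod_of_monic _ _ fun P hP => hm P (Finset.mem_filter.1 hP).1,
      Finset.sum_filter_add_sum_filter_not, Polynomial.radDeg]
  · intro P hP hPD
    rw [hDA] at hPD
    exact (hP.prime.dvd_or_dvd hPD).imp id hP.prime.dvd_of_dvd_pow

theorem degPart_le_radDeg (D : Fq[X]) (k : ℕ) : degPart D k ≤ D.radDeg :=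
  Finset.sum_le_sum_of_subset (Finset.filter_subset _ _)

end Factorization

section Counting

variable {Fq : Type*} [Field Fq] [Fintype Fq]

theorem finite_setOf_monic_natDegree_eq (n : ℕ) :
    {p : Fq[X] | p.Monic ∧ p.natDegree = n}.Finite :=
  Finite.of_equiv _ ((monicEquivDegreeLT (R := Fq) n).trans (degreeLTEquiv Fq n).toEquiv).symm

/-- The finite set of monic polynomials of degree `n` over a finite field. -/
noncomputable def monicsOfDegree (Fq : Type*) [Field Fq] [Fintype Fq] (n : ℕ) : Finset Fq[X] :=
  (finite_setOf_monic_natDegree_eq (Fq := Fq) n).toFinset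

theorem mem_monicsOfDegree {n : ℕ} {p : Fq[X]} :
    p ∈ monicsOfDegree Fq n ↔ p.Monic ∧ p.natDegree = n := by
  simp [monicsOfDegree]

theorem card_monicsOfDegree (n : ℕ) :
    (monicsOfDegree Fq n).card = Fintype.card Fq ^ n := by
  rw [monicsOfDegree, ← Set.ncard_eq_toFinset_card _ (finite_setOf_monic_natDegree_eq n),
    ← Nat.card_coe_set_eq]
  refine (Nat.card_congr
    ((monicEquivDegreeLT (R := Fq) n).trans (degreeLTEquiv Fq n).toEquiv)).trans ?_
  simp

theorem natCard_degreeLT (n : ℕ) : Nat.card (degreeLT Fq n) = Fintype.card Fq ^ n := by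
  rw [Nat.card_congr (degreeLTEquiv Fq n).toEquiv]
  simp

theorem card_le_of_pairwise_dvd_sub {M : Fq[X]} (hM : M ≠ 0) {n : ℕ} {S : Finset Fq[X]}
    (hS : S ⊆ monicsOfDegree Fq n) (h : ∀ x ∈ S, ∀ y ∈ S, M ∣ x - y) :
    S.card ≤ Fintype.card Fq ^ (n - M.natDegree) := by
  classical
  obtain rfl | ⟨y, hy⟩ := S.eq_empty_or_nonempty
  · simp
  rw [← natCard_degreeLT, ← Nat.card_eq_finsetCard S]
  have key : ∀ x : S, ∃ f : degreeLT Fq (n - M.natDegree), (x : Fq[X]) - y = M * f := by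
    rintro ⟨x, hx⟩
    obtain ⟨f, hf⟩ := h x hx y hy
    refine ⟨⟨f, ?_⟩, hf⟩
    rw [mem_degreeLT]
    obtain ⟨hxm, hxn⟩ := mem_monicsOfDegree.1 (hS hx)
    obtain ⟨hym, hyn⟩ := mem_monicsOfDegree.1 (hS hy)
    by_cases hf0 : f = 0
    · subst hf0; simp
    have hlt : (x - y).degree < n := by
      rw [← hxn, ← degree_eq_natDegree hxm.ne_zero]
      apply degree_sub_lt_left _ hxm.ne_zero
      · rw [hxm, hym]
      · rw [degree_eq_natDegree hxm.ne_zero, degree_eq_natDegree hym.ne_zero, hxn, hyn]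
    rw [hf, degree_mul, degree_eq_natDegree hM, degree_eq_natDegree hf0] at hlt
    rw [degree_eq_natDegree hf0]
    norm_cast at hlt ⊢
    omega
  choose f hf using key
  have : Finite (degreeLT Fq (n - M.natDegree)) :=
    Finite.of_equiv _ (degreeLTEquiv Fq (n - M.natDegree)).toEquiv.symm
  refine Nat.card_le_card_of_injective f fun x z hxz => Subtype.ext ?_
  have h1 := hf x
  rw [hxz, ← hf z] at h1
  simpa using h1

theorem card_filter_dvd_mul_le {P : Fq[X]} (hP : P.Monic) (n : ℕ)
    [DecidablePred (P ∣ · : Fq[X] → Prop)] :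
    ((monicsOfDegree Fq n).filter (P ∣ ·)).card * Fintype.card Fq ^ P.natDegree
      ≤ Fintype.card Fq ^ n := by
  by_cases hn : P.natDegree ≤ n
  · calc _ ≤ Fintype.card Fq ^ (n - P.natDegree) * Fintype.card Fq ^ P.natDegree := by
          gcongr
          refine card_le_of_pairwise_dvd_sub hP.ne_zero (Finset.filter_subset _ _) ?_
          intro x hx y hy
          exact dvd_sub (Finset.mem_filter.1 hx).2 (Finset.mem_filter.1 hy).2
      _ = _ := by rw [← pow_add, Nat.sub_add_cancel hn]
  · rw [Finset.filter_false_of_mem]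
    · simp
    · intro x hx hd
      obtain ⟨hxm, hxn⟩ := mem_monicsOfDegree.1 hx
      exact hn (hxn ▸ natDegree_le_of_dvd hd hxm.ne_zero)

theorem mul_card_filter_irreducible_le {k : ℕ} (hk : 1 ≤ k)
    [DecidablePred (Irreducible : Fq[X] → Prop)] :
    k * ((monicsOfDegree Fq k).filter Irreducible).card ≤ Fintype.card Fq ^ k := by
  set I := (monicsOfDegree Fq k).filter Irreducible with hI
  have hmem : ∀ P ∈ I, P.Monic ∧ P.natDegree = k ∧ Irreducible P := by
    intro P hP
    rw [hI, Finset.mem_filter, mem_monicsOfDegree] at hP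
    tauto
  have hdvd : ∏ P ∈ I, P ∣ X ^ Fintype.card Fq ^ k - X := by
    refine Finset.prod_dvd_of_coprime ?_ ?_
    · intro P hP Q hQ hPQ
      obtain ⟨hPm, hPk, hPi⟩ := hmem P hP
      obtain ⟨hQm, hQk, hQi⟩ := hmem Q hQ
      refine (hPi.coprime_iff_not_dvd).2 fun h => hPQ ?_
      exact eq_of_monic_of_associated hPm hQm (hPi.associated_of_dvd hQi h)
    · intro P hP
      obtain ⟨hPm, hPk, hPi⟩ := hmem P hP
      rw [← Nat.card_eq_fintype_card]
      exact (hPi.natDegree_dvd_iff_dvd_X_pow_card_pow_sub_X).1 hPk.dvd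
  have hdeg := natDegree_le_of_dvd hdvd
    (FiniteField.X_pow_card_pow_sub_X_ne_zero _ (by omega) Fintype.one_lt_card)
  rw [FiniteField.X_pow_card_pow_sub_X_natDegree_eq _ (by omega) Fintype.one_lt_card,
    natDegree_prod _ _ fun P hP => (hmem P hP).1.ne_zero,
    Finset.sum_congr rfl fun P hP => (hmem P hP).2.1] at hdeg
  simpa [mul_comm] using hdeg

theorem sum_monicsOfDegree_le {f : Fq[X] → ℝ} {c : ℝ} (d : ℕ) (p : Fq[X] → Prop) [DecidablePred p]
    (hc : 0 ≤ c) (h : ∀ P ∈ monicsOfDegree Fq d, p P → f P ≤ c) :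
    ∑ P ∈ (monicsOfDegree Fq d).filter p, f P ≤ (Fintype.card Fq : ℝ) ^ d * c := by
  calc _ ≤ ∑ P ∈ (monicsOfDegree Fq d).filter p, c := Finset.sum_le_sum fun P hP =>
          h P (Finset.mem_filter.1 hP).1 (Finset.mem_filter.1 hP).2
    _ ≤ _ := by
      rw [Finset.sum_const, nsmul_eq_mul]
      gcongr
      exact_mod_cast (Finset.card_filter_le _ _).trans_eq (card_monicsOfDegree d)

open Classical in
/-- The monic polynomials of degree `n` congruent to `1` modulo `W`. -/
noncomputable def monicsOneMod (W : Fq[X]) (n : ℕ) : Finset Fq[X] :=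
  (monicsOfDegree Fq n).filter (W ∣ · - 1)

theorem mem_monicsOneMod {W D : Fq[X]} {n : ℕ} :
    D ∈ monicsOneMod W n ↔ (D.Monic ∧ D.natDegree = n) ∧ W ∣ D - 1 := by
  classical
  rw [monicsOneMod, Finset.mem_filter, mem_monicsOfDegree]

theorem card_monicsOneMod {W : Fq[X]} (hW : W.Monic) {n : ℕ} (hn : W.natDegree < n) :
    ((monicsOneMod W n).card : ℝ) =
      (Fintype.card Fq : ℝ) ^ n / (Fintype.card Fq : ℝ) ^ W.natDegree := by
  have hq : (Fintype.card Fq : ℝ) ≠ 0 := by exact_mod_cast Fintype.card_ne_zero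
  rw [div_eq_mul_inv, ← pow_sub₀ _ hq hn.le]
  have h1 : (monicsOneMod W n).card ≤ Fintype.card Fq ^ (n - W.natDegree) := by
    refine card_le_of_pairwise_dvd_sub hW.ne_zero (fun x hx =>
      mem_monicsOfDegree.2 (mem_monicsOneMod.1 hx).1) fun x hx y hy => ?_
    have := dvd_sub (mem_monicsOneMod.1 hx).2 (mem_monicsOneMod.1 hy).2
    rwa [sub_sub_sub_cancel_right] at this
  have h2 : Fintype.card Fq ^ (n - W.natDegree) ≤ (monicsOneMod W n).card := by
    rw [← card_monicsOfDegree (Fq := Fq)]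
    refine Finset.card_le_card_of_injOn (fun f => W * f + 1) ?_ ?_
    · intro f hf
      obtain ⟨hfm, hfn⟩ := mem_monicsOfDegree.1 hf
      have hd : (W * f).natDegree = n := by rw [hW.natDegree_mul hfm, hfn]; omega
      refine mem_monicsOneMod.2 ⟨⟨?_, ?_⟩, ?_⟩
      · refine (hW.mul hfm).add_of_left ?_
        rw [degree_one, degree_eq_natDegree (hW.mul hfm).ne_zero, hd]
        exact_mod_cast (by omega : 0 < n)
      · rw [← C_1, natDegree_add_C, hd]
      · simp
    · intro f _ g _ h
      simpa [hW.ne_zero] using h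
  exact_mod_cast le_antisymm h1 h2

open Classical in
theorem card_filter_dvd_monicsOneMod_le {W Q : Fq[X]} (hW : W.Monic) (hQ : Q.Monic)
    (hQW : IsCoprime Q W) (n : ℕ) :
    (((monicsOneMod W n).filter (Q ∣ ·)).card : ℝ) ≤
      (Fintype.card Fq : ℝ) ^ n / (Fintype.card Fq : ℝ) ^ W.natDegree
        / (Fintype.card Fq : ℝ) ^ Q.natDegree + 1 := by
  have hq : 0 < (Fintype.card Fq : ℝ) := by exact_mod_cast Fintype.card_pos
  have h1 : ((monicsOneMod W n).filter (Q ∣ ·)).card ≤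
      Fintype.card Fq ^ (n - (W * Q).natDegree) := by
    refine card_le_of_pairwise_dvd_sub (hW.mul hQ).ne_zero
      ((Finset.filter_subset _ _).trans (Finset.filter_subset _ _)) fun x hx y hy => ?_
    rw [Finset.mem_filter, mem_monicsOneMod] at hx hy
    refine hQW.symm.mul_dvd ?_ (dvd_sub hx.2 hy.2)
    have := dvd_sub hx.1.2 hy.1.2
    rwa [sub_sub_sub_cancel_right] at this
  rw [hW.natDegree_mul hQ] at h1
  have h2 : (((monicsOneMod W n).filter (Q ∣ ·)).card : ℝ) ≤
      (Fintype.card Fq : ℝ) ^ (n - (W.natDegree + Q.natDegree)) := by exact_mod_cast h1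
  refine h2.trans ?_
  rw [div_div, ← pow_add]
  obtain h | h := le_total (W.natDegree + Q.natDegree) n
  · rw [div_eq_mul_inv, ← pow_sub₀ _ hq.ne' h]
    linarith
  · rw [Nat.sub_eq_zero_of_le h, pow_zero]
    have : 0 ≤ (Fintype.card Fq : ℝ) ^ n / (Fintype.card Fq : ℝ) ^ (W.natDegree + Q.natDegree) := by
      positivity
    linarith

variable [DecidableEq Fq]

theorem finite_cubicTwistFamily (B : Fq[X]) (N : ℕ) : (cubicTwistFamily B N).Finite := by
  refine Set.Finite.subset (((Finset.HasAntidiagonal.antidiagonal N).biUnion fun x =>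
    monicsOfDegree Fq x.1 ×ˢ monicsOfDegree Fq x.2).image fun x => x.1 * x.2 ^ 2).finite_toSet ?_
  rintro D ⟨hD, hc, -, hN, -⟩
  obtain ⟨A, E, hA, hE, rfl, hdeg, -⟩ := exists_mul_sq_eq hD hc
  rw [Finset.mem_coe, Finset.mem_image]
  refine ⟨(A, E), ?_, rfl⟩
  simp [mem_monicsOfDegree, hA, hE, hdeg, hN]

open Classical in
theorem card_filter_dvd_cubicTwistFamily_le {B P : Fq[X]} {N : ℕ} (hP : P.Monic)
    (hPi : Irreducible P) :
    ((finite_cubicTwistFamily B N).toFinset.filter (P ∣ ·)).card * Fintype.card Fq ^ P.natDegree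
      ≤ (N + 1) * (2 * Fintype.card Fq ^ N) := by
  set T : ℕ × ℕ → Finset (Fq[X] × Fq[X]) := fun x =>
    (monicsOfDegree Fq x.1).filter (P ∣ ·) ×ˢ monicsOfDegree Fq x.2 ∪
      monicsOfDegree Fq x.1 ×ˢ (monicsOfDegree Fq x.2).filter (P ∣ ·) with hT
  have hsub : (finite_cubicTwistFamily B N).toFinset.filter (P ∣ ·) ⊆
      ((Finset.HasAntidiagonal.antidiagonal N).biUnion T).image fun x => x.1 * x.2 ^ 2 := by
    intro D hD
    rw [Finset.mem_filter, Set.Finite.mem_toFinset] at hD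
    obtain ⟨⟨hD, hc, -, hN, -⟩, hPD⟩ := hD
    obtain ⟨A, E, hA, hE, rfl, hdeg, hdvd⟩ := exists_mul_sq_eq hD hc
    rw [Finset.mem_image]
    refine ⟨(A, E), ?_, rfl⟩
    have := hdvd P hPi hPD
    simp only [hT, Finset.mem_biUnion, Prod.exists, Finset.HasAntidiagonal.mem_antidiagonal,
      Finset.mem_union, Finset.mem_product, Finset.mem_filter, mem_monicsOfDegree, hA, hE, true_and]
    exact ⟨_, _, hdeg.trans hN, by tauto⟩
  have hTc : ∀ x ∈ Finset.HasAntidiagonal.antidiagonal N,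
      (T x).card * Fintype.card Fq ^ P.natDegree ≤ 2 * Fintype.card Fq ^ N := by
    intro x hx
    rw [Finset.HasAntidiagonal.mem_antidiagonal] at hx
    have h1 := card_filter_dvd_mul_le hP x.1
    have h2 := card_filter_dvd_mul_le hP x.2
    calc (T x).card * Fintype.card Fq ^ P.natDegree
        ≤ (((monicsOfDegree Fq x.1).filter (P ∣ ·)).card * Fintype.card Fq ^ x.2 +
          Fintype.card Fq ^ x.1 * ((monicsOfDegree Fq x.2).filter (P ∣ ·)).card)
            * Fintype.card Fq ^ P.natDegree := by
          gcongr
          refine (Finset.card_union_le _ _).trans_eq ?_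
          simp only [Finset.card_product, card_monicsOfDegree]
      _ = (((monicsOfDegree Fq x.1).filter (P ∣ ·)).card * Fintype.card Fq ^ P.natDegree)
            * Fintype.card Fq ^ x.2 + Fintype.card Fq ^ x.1 *
            (((monicsOfDegree Fq x.2).filter (P ∣ ·)).card * Fintype.card Fq ^ P.natDegree) := by
          ring
      _ ≤ Fintype.card Fq ^ x.1 * Fintype.card Fq ^ x.2
            + Fintype.card Fq ^ x.1 * Fintype.card Fq ^ x.2 := by gcongr
      _ = 2 * Fintype.card Fq ^ N := by rw [← pow_add, hx]; ring
  calc _ ≤ (∑ x ∈ Finset.HasAntidiagonal.antidiagonal N, (T x).card) * Fintype.card Fq ^ P.natDegree := by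
        gcongr
        exact (Finset.card_le_card hsub).trans (Finset.card_image_le.trans Finset.card_biUnion_le)
    _ ≤ ∑ x ∈ Finset.HasAntidiagonal.antidiagonal N, 2 * Fintype.card Fq ^ N := by
        rw [Finset.sum_mul]
        exact Finset.sum_le_sum hTc
    _ = _ := by simp

theorem sum_degPart_cubicTwistFamily_le (B : Fq[X]) (N k : ℕ) :
    ∑ D ∈ (finite_cubicTwistFamily B N).toFinset, degPart D k
      ≤ 2 * (N + 1) * Fintype.card Fq ^ N := by
  classical
  obtain rfl | hk := Nat.eq_zero_or_pos k
  · refine (Finset.sum_eq_zero fun D _ => ?_).trans_le (Nat.zero_le _)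
    exact Finset.sum_eq_zero fun P hP => (Finset.mem_filter.1 hP).2
  set F := (finite_cubicTwistFamily B N).toFinset
  set I := (monicsOfDegree Fq k).filter Irreducible with hI
  have hdeg : ∀ D ∈ F, degPart D k = ∑ P ∈ I, if P ∣ D then k else 0 := by
    intro D hD
    have hD0 : D ≠ 0 := ((finite_cubicTwistFamily B N).mem_toFinset.1 hD).1.ne_zero
    rw [degPart, ← Finset.sum_filter]
    refine Finset.sum_congr ?_ ?_
    · ext P
      simp only [hI, Finset.mem_filter, Multiset.mem_toFinset, mem_monicsOfDegree,
        Polynomial.mem_normalizedFactors_iff hD0]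
      tauto
    · intro P hP
      simp only [hI, Finset.mem_filter, mem_monicsOfDegree] at hP
      exact hP.1.1.2
  have hq : 0 < Fintype.card Fq ^ k := pow_pos Fintype.card_pos _
  refine Nat.le_of_mul_le_mul_right ?_ hq
  calc (∑ D ∈ F, degPart D k) * Fintype.card Fq ^ k
      = ∑ P ∈ I, k * ((F.filter (P ∣ ·)).card * Fintype.card Fq ^ k) := by
        rw [Finset.sum_congr rfl hdeg, Finset.sum_comm, Finset.sum_mul]
        refine Finset.sum_congr rfl fun P _ => ?_
        rw [← Finset.sum_filter, Finset.sum_const, smul_eq_mul]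
        ring
    _ ≤ ∑ P ∈ I, k * ((N + 1) * (2 * Fintype.card Fq ^ N)) := by
        refine Finset.sum_le_sum fun P hP => Nat.mul_le_mul_left _ ?_
        simp only [hI, Finset.mem_filter, mem_monicsOfDegree] at hP
        obtain ⟨⟨hPm, hPk⟩, hPi⟩ := hP
        have := card_filter_dvd_cubicTwistFamily_le (B := B) (N := N) hPm hPi
        rwa [hPk] at this
    _ = (k * I.card) * (2 * (N + 1) * Fintype.card Fq ^ N) := by
        rw [Finset.sum_const, smul_eq_mul]; ring
    _ ≤ Fintype.card Fq ^ k * (2 * (N + 1) * Fintype.card Fq ^ N) := by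
        gcongr
        exact mul_card_filter_irreducible_le hk
    _ = _ := by ring

open Classical in
theorem card_filter_not_squarefree_le {W : Fq[X]} (hW : W.Monic)
    (hW3 : ∀ P : Fq[X], P.Monic → P.natDegree ≤ 3 → P ∣ W) (n : ℕ) :
    (((monicsOneMod W n).filter (¬ Squarefree ·)).card : ℝ) ≤
      (Fintype.card Fq : ℝ) ^ n / (Fintype.card Fq : ℝ) ^ W.natDegree / 8
        + (n + 1) * (Fintype.card Fq : ℝ) ^ (n / 2) := by
  set q : ℝ := ((Fintype.card Fq : ℕ) : ℝ) with hqdef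
  have hq2 : 2 ≤ q := by
    rw [hqdef]; exact_mod_cast (Fintype.one_lt_card : 1 < Fintype.card Fq)
  have hq : 0 < q := by linarith
  set x := q ^ n / q ^ W.natDegree with hx
  have hx0 : 0 ≤ x := by positivity
  have hsub : (monicsOneMod W n).filter (¬ Squarefree ·) ⊆
      (Finset.Icc 4 (n / 2)).biUnion fun d => ((monicsOfDegree Fq d).filter (IsCoprime · W)).biUnion
        fun P => (monicsOneMod W n).filter (P ^ 2 ∣ ·) := by
    intro D hD
    obtain ⟨hD, hDs⟩ := Finset.mem_filter.1 hD
    obtain ⟨⟨hDm, hDn⟩, hDW⟩ := mem_monicsOneMod.1 hD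
    rw [squarefree_iff_irreducible_sq_not_dvd_of_ne_zero hDm.ne_zero] at hDs
    push Not at hDs
    obtain ⟨P, hPi, hPD⟩ := hDs
    have hP2 : normalize P ^ 2 ∣ D := by
      rw [sq]
      exact (mul_dvd_mul (normalize_dvd_iff.2 dvd_rfl) (normalize_dvd_iff.2 dvd_rfl)).trans hPD
    have hPm := monic_normalize hPi.ne_zero
    obtain ⟨h4, hc⟩ := four_le_natDegree_of_dvd hW3 hDW hPm
      ((normalize_associated P).irreducible_iff.2 hPi) ((dvd_pow_self _ two_ne_zero).trans hP2)
    have hdeg := natDegree_le_of_dvd hP2 hDm.ne_zero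
    rw [hPm.natDegree_pow] at hdeg
    simp only [Finset.mem_biUnion, Finset.mem_filter, Finset.mem_Icc, mem_monicsOfDegree]
    exact ⟨_, ⟨h4, by omega⟩, normalize P, ⟨⟨hPm, rfl⟩, hc⟩, hD, hP2⟩
  calc (((monicsOneMod W n).filter (¬ Squarefree ·)).card : ℝ)
      ≤ ∑ d ∈ Finset.Icc 4 (n / 2), ∑ P ∈ (monicsOfDegree Fq d).filter (IsCoprime · W),
          (((monicsOneMod W n).filter (P ^ 2 ∣ ·)).card : ℝ) := by
        exact_mod_cast (Finset.card_le_card hsub).trans (Finset.card_biUnion_le.trans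
          (Finset.sum_le_sum fun d _ => Finset.card_biUnion_le))
    _ ≤ ∑ d ∈ Finset.Icc 4 (n / 2), q ^ d * (x / q ^ (2 * d) + 1) := by
        refine Finset.sum_le_sum fun d _ => sum_monicsOfDegree_le d _ (by positivity) ?_
        intro P hP hPW
        obtain ⟨hPm, hPd⟩ := mem_monicsOfDegree.1 hP
        have := card_filter_dvd_monicsOneMod_le hW (hPm.pow 2) hPW.pow_left n
        rwa [hPm.natDegree_pow, hPd] at this
    _ ≤ ∑ d ∈ Finset.Icc 4 (n / 2), (x * (q ^ d)⁻¹ + q ^ (n / 2)) := by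
        refine Finset.sum_le_sum fun d hd => ?_
        have h1 : q ^ d ≤ q ^ (n / 2) := pow_le_pow_right₀ (by linarith) (Finset.mem_Icc.1 hd).2
        have h2 : q ^ d * (x / q ^ (2 * d) + 1) = x * (q ^ d)⁻¹ + q ^ d := by
          rw [two_mul, pow_add]; field_simp
        rw [h2]
        linarith
    _ ≤ x / 8 + (n + 1) * q ^ (n / 2) := by
        rw [Finset.sum_add_distrib, ← Finset.mul_sum, Finset.sum_const, nsmul_eq_mul]
        have h1 := mul_le_mul_of_nonneg_left (sum_Icc_four_inv_pow_le hq2 (n / 2)) hx0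
        have h2 : ((Finset.Icc 4 (n / 2)).card : ℝ) ≤ n + 1 := by
          rw [Nat.card_Icc]; exact_mod_cast (by omega)
        have h3 := mul_le_mul_of_nonneg_right h2 (by positivity : 0 ≤ q ^ (n / 2))
        linarith

open Classical in
theorem card_filter_not_isCoprime_le {W : Fq[X]} (hW : W.Monic)
    (hW3 : ∀ P : Fq[X], P.Monic → P.natDegree ≤ 3 → P ∣ W) (a b : ℕ) {x y : ℝ}
    (hx : x = (Fintype.card Fq : ℝ) ^ a / (Fintype.card Fq : ℝ) ^ W.natDegree)
    (hy : y = (Fintype.card Fq : ℝ) ^ b / (Fintype.card Fq : ℝ) ^ W.natDegree) :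
    (((monicsOneMod W a ×ˢ monicsOneMod W b).filter fun z => ¬ IsCoprime z.1 z.2).card : ℝ) ≤
      x * y / 8 + ((b + 1) * x + (a + 1) * y + (a + 1) * (Fintype.card Fq : ℝ) ^ b) := by
  set q : ℝ := ((Fintype.card Fq : ℕ) : ℝ) with hqdef
  have hq2 : 2 ≤ q := by
    rw [hqdef]; exact_mod_cast (Fintype.one_lt_card : 1 < Fintype.card Fq)
  have hq : 0 < q := by linarith
  have hx0 : 0 ≤ x := by rw [hx]; positivity
  have hy0 : 0 ≤ y := by rw [hy]; positivity
  have hsub : ((monicsOneMod W a ×ˢ monicsOneMod W b).filter fun z => ¬ IsCoprime z.1 z.2) ⊆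
      (Finset.Icc 4 (min a b)).biUnion fun d =>
        ((monicsOfDegree Fq d).filter (IsCoprime · W)).biUnion fun P =>
          (monicsOneMod W a).filter (P ∣ ·) ×ˢ (monicsOneMod W b).filter (P ∣ ·) := by
    rintro ⟨D, E⟩ hDE
    rw [Finset.mem_filter, Finset.mem_product] at hDE
    obtain ⟨⟨hD, hE⟩, hDE⟩ := hDE
    obtain ⟨⟨hDm, hDn⟩, hDW⟩ := mem_monicsOneMod.1 hD
    obtain ⟨⟨hEm, hEn⟩, hEW⟩ := mem_monicsOneMod.1 hE
    have : ∃ P, Irreducible P ∧ P ∣ D ∧ P ∣ E := by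
      by_contra! hcon
      exact hDE (isCoprime_of_irreducible_dvd (fun h => hDm.ne_zero h.1) hcon)
    obtain ⟨P, hPi, hPD, hPE⟩ := this
    have hPm := monic_normalize hPi.ne_zero
    rw [← normalize_dvd_iff] at hPD hPE
    obtain ⟨h4, hc⟩ := four_le_natDegree_of_dvd hW3 hDW hPm
      ((normalize_associated P).irreducible_iff.2 hPi) hPD
    have hdeg := natDegree_le_of_dvd hPD hDm.ne_zero
    have hdeg' := natDegree_le_of_dvd hPE hEm.ne_zero
    simp only [Finset.mem_biUnion, Finset.mem_filter, Finset.mem_Icc, mem_monicsOfDegree,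
      Finset.mem_product]
    exact ⟨_, ⟨h4, le_min (hdeg.trans_eq hDn) (hdeg'.trans_eq hEn)⟩, normalize P,
      ⟨⟨hPm, rfl⟩, hc⟩, ⟨hD, hPD⟩, hE, hPE⟩
  have hcard : (((Finset.Icc 4 (min a b)).card : ℕ) : ℝ) ≤ a + 1 ∧
      (((Finset.Icc 4 (min a b)).card : ℕ) : ℝ) ≤ b + 1 := by
    rw [Nat.card_Icc]
    exact ⟨by exact_mod_cast (by omega), by exact_mod_cast (by omega)⟩
  calc (((monicsOneMod W a ×ˢ monicsOneMod W b).filter fun z => ¬ IsCoprime z.1 z.2).card : ℝ)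
      ≤ ∑ d ∈ Finset.Icc 4 (min a b), ∑ P ∈ (monicsOfDegree Fq d).filter (IsCoprime · W),
          (((monicsOneMod W a).filter (P ∣ ·)).card : ℝ) *
            (((monicsOneMod W b).filter (P ∣ ·)).card : ℝ) := by
        refine le_trans (Nat.cast_le.2 ((Finset.card_le_card hsub).trans
          (Finset.card_biUnion_le.trans
            (Finset.sum_le_sum fun d _ => Finset.card_biUnion_le)))) ?_
        simp only [Finset.card_product, Nat.cast_sum, Nat.cast_mul]
        rfl
    _ ≤ ∑ d ∈ Finset.Icc 4 (min a b), q ^ d * ((x / q ^ d + 1) * (y / q ^ d + 1)) := by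
        refine Finset.sum_le_sum fun d _ => sum_monicsOfDegree_le d _ (by positivity) ?_
        intro P hP hPW
        obtain ⟨hPm, hPd⟩ := mem_monicsOfDegree.1 hP
        have h1 := card_filter_dvd_monicsOneMod_le hW hPm hPW a
        have h2 := card_filter_dvd_monicsOneMod_le hW hPm hPW b
        rw [hPd, ← hqdef] at h1 h2
        rw [← hx] at h1
        rw [← hy] at h2
        exact mul_le_mul h1 h2 (by positivity) (by positivity)
    _ ≤ ∑ d ∈ Finset.Icc 4 (min a b), (x * y * (q ^ d)⁻¹ + (x + y + q ^ b)) := by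
        refine Finset.sum_le_sum fun d hd => ?_
        have h1 : q ^ d ≤ q ^ b := pow_le_pow_right₀ (by linarith)
          ((Finset.mem_Icc.1 hd).2.trans (min_le_right _ _))
        have h2 : q ^ d * ((x / q ^ d + 1) * (y / q ^ d + 1)) =
            x * y * (q ^ d)⁻¹ + (x + y + q ^ d) := by
          field_simp; ring
        rw [h2]
        linarith
    _ ≤ _ := by
        rw [Finset.sum_add_distrib, ← Finset.mul_sum, Finset.sum_const, nsmul_eq_mul]
        have h1 := mul_le_mul_of_nonneg_left (sum_Icc_four_inv_pow_le hq2 (min a b))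
          (mul_nonneg hx0 hy0)
        have h2 := mul_le_mul_of_nonneg_right hcard.2 hx0
        have h3 := mul_le_mul_of_nonneg_right hcard.1 hy0
        have h4 := mul_le_mul_of_nonneg_right hcard.1 (by positivity : 0 ≤ q ^ b)
        linarith

open Classical in
/-- Pairs of coprime squarefree monic polynomials of degrees `a` and `b`, both congruent to `1`
modulo `W`. -/
noncomputable def squarefreePairs (W : Fq[X]) (a b : ℕ) : Finset (Fq[X] × Fq[X]) :=
  (monicsOneMod W a ×ˢ monicsOneMod W b).filter fun z =>
    Squarefree z.1 ∧ Squarefree z.2 ∧ IsCoprime z.1 z.2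

theorem le_card_squarefreePairs {W : Fq[X]} (hW : W.Monic)
    (hW3 : ∀ P : Fq[X], P.Monic → P.natDegree ≤ 3 → P ∣ W) {a b : ℕ}
    (haW : W.natDegree < a) (hbW : W.natDegree < b)
    (ha : 64 * (a + 1) * (Fintype.card Fq : ℝ) ^ (2 * W.natDegree) ≤
      (Fintype.card Fq : ℝ) ^ (a / 2))
    (hb : 64 * (b + 1) * (Fintype.card Fq : ℝ) ^ (2 * W.natDegree) ≤
      (Fintype.card Fq : ℝ) ^ (b / 2)) :
    (Fintype.card Fq : ℝ) ^ (a + b) / (2 * (Fintype.card Fq : ℝ) ^ (2 * W.natDegree)) ≤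
      (squarefreePairs W a b).card := by
  classical
  have hca := card_monicsOneMod hW haW
  have hcb := card_monicsOneMod hW hbW
  have hsa := card_filter_not_squarefree_le hW hW3 a
  have hsb := card_filter_not_squarefree_le hW hW3 b
  have hco := card_filter_not_isCoprime_le hW hW3 a b rfl rfl
  set w := W.natDegree
  set q : ℝ := ((Fintype.card Fq : ℕ) : ℝ) with hqdef
  have hq2 : 2 ≤ q := by
    rw [hqdef]; exact_mod_cast (Fintype.one_lt_card : 1 < Fintype.card Fq)
  have hq : 0 < q := by linarith
  have hw1 : 1 ≤ q ^ w := one_le_pow₀ (by linarith)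
  have key : ∀ n : ℕ, 64 * (n + 1) * q ^ (2 * w) ≤ q ^ (n / 2) →
      (n + 1) * q ^ (n / 2) ≤ q ^ n / q ^ w / 64 ∧ (n + 1) * q ^ w ≤ q ^ n / q ^ w / 64 ∧
        (n + 1) ≤ q ^ n / q ^ w / 64 := by
    intro n hn
    have hn2 : 1 ≤ q ^ (n / 2) := one_le_pow₀ (by linarith)
    have hsq : q ^ (n / 2) * q ^ (n / 2) ≤ q ^ n := by
      rw [← pow_add]; exact pow_le_pow_right₀ (by linarith) (by omega)
    have hww : q ^ (2 * w) = q ^ w * q ^ w := by rw [two_mul, pow_add]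
    rw [hww] at hn
    have hpos : (0 : ℝ) ≤ n + 1 := by positivity
    have hA : (n + 1) * q ^ w ≤ q ^ n / q ^ w / 64 := by
      rw [le_div_iff₀ (by norm_num), le_div_iff₀ (by positivity)]
      nlinarith
    refine ⟨?_, hA, le_trans (le_mul_of_one_le_right hpos hw1) hA⟩
    rw [le_div_iff₀ (by norm_num), le_div_iff₀ (by positivity)]
    have h1 : (n + 1) * q ^ w ≤ (n + 1) * (q ^ w * q ^ w) :=
      mul_le_mul_of_nonneg_left (le_mul_of_one_le_right (by positivity) hw1) hpos
    calc _ = (64 * ((n + 1) * q ^ w)) * q ^ (n / 2) := by ring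
      _ ≤ q ^ (n / 2) * q ^ (n / 2) := by
        gcongr
        linarith
      _ ≤ _ := hsq
  obtain ⟨ha1, ha2, ha3⟩ := key a ha
  obtain ⟨hb1, hb2, hb3⟩ := key b hb
  have hqb : q ^ b = q ^ b / q ^ w * q ^ w := by field_simp
  have hxy : q ^ (a + b) / (2 * q ^ (2 * w)) = (q ^ a / q ^ w) * (q ^ b / q ^ w) / 2 := by
    rw [mul_comm 2 w, pow_mul, pow_add]; field_simp
  rw [hxy]
  set x := q ^ a / q ^ w
  set y := q ^ b / q ^ w
  have hx0 : 0 ≤ x := by positivity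
  have hy0 : 0 ≤ y := by positivity
  set bA := (monicsOneMod W a).filter (¬ Squarefree ·)
  set bB := (monicsOneMod W b).filter (¬ Squarefree ·)
  set bC := (monicsOneMod W a ×ˢ monicsOneMod W b).filter fun z => ¬ IsCoprime z.1 z.2
  have hsub : monicsOneMod W a ×ˢ monicsOneMod W b ⊆ ((squarefreePairs W a b ∪
      bA ×ˢ monicsOneMod W b) ∪ monicsOneMod W a ×ˢ bB) ∪ bC := by
    intro z hz
    simp only [bA, bB, bC, squarefreePairs, Finset.mem_union, Finset.mem_filter,
      Finset.mem_product] at hz ⊢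
    tauto
  have hle : (x * y : ℝ) ≤ (squarefreePairs W a b).card + bA.card * y + x * bB.card + bC.card := by
    rw [← hca, ← hcb]
    have := (Finset.card_le_card hsub).trans ((Finset.card_union_le _ _).trans
      (Nat.add_le_add_right ((Finset.card_union_le _ _).trans
        (Nat.add_le_add_right (Finset.card_union_le _ _) _)) _))
    simp only [Finset.card_product] at this
    exact_mod_cast this
  have e1 : bA.card * y ≤ (x / 8 + x / 64) * y := by gcongr; linarith
  have e2 : x * bB.card ≤ x * (y / 8 + y / 64) := by gcongr; linarith
  have e3 : (b + 1) * x ≤ y / 64 * x := by gcongr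
  have e4 : (a + 1) * y ≤ x / 64 * y := by gcongr
  have e5 : (a + 1) * q ^ b ≤ x / 64 * y := by
    rw [hqb]
    calc (a + 1) * (y * q ^ w) = ((a + 1) * q ^ w) * y := by ring
      _ ≤ _ := by gcongr
  nlinarith [mul_nonneg hx0 hy0]

theorem le_ncard_cubicTwistFamily {B W : Fq[X]} (hW : W.Monic)
    (hW3 : ∀ P : Fq[X], P.Monic → P.natDegree ≤ 3 → P ∣ W) (hBW : B ∣ W) {M : ℕ}
    (hM : ∀ n : ℕ, M ≤ n → W.natDegree < n ∧ 64 * (n + 1) *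
      (Fintype.card Fq : ℝ) ^ (2 * W.natDegree) ≤ (Fintype.card Fq : ℝ) ^ (n / 2))
    (N : ℕ) :
    ((N - 2 * M) / 3 : ℕ) * ((Fintype.card Fq : ℝ) ^ N /
      (2 * (Fintype.card Fq : ℝ) ^ (2 * W.natDegree))) ≤ (cubicTwistFamily B N).ncard := by
  classical
  set r := M + (2 * N - M) % 3 with hr
  set t := (N - 2 * M) / 3 with ht
  set S := (Finset.range t).biUnion fun i => squarefreePairs W (r + 3 * i) (N - (r + 3 * i))
  have hmem : ∀ z ∈ S, ∃ i < t, ((z.1.Monic ∧ z.1.natDegree = r + 3 * i) ∧ W ∣ z.1 - 1) ∧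
      ((z.2.Monic ∧ z.2.natDegree = N - (r + 3 * i)) ∧ W ∣ z.2 - 1) ∧
        Squarefree z.1 ∧ Squarefree z.2 ∧ IsCoprime z.1 z.2 := by
    intro z hz
    simpa only [S, Finset.mem_biUnion, Finset.mem_range, squarefreePairs, Finset.mem_filter,
      Finset.mem_product, mem_monicsOneMod, and_assoc] using hz
  have hS : S.card ≤ (cubicTwistFamily B N).ncard := by
    rw [Set.ncard_eq_toFinset_card _ (finite_cubicTwistFamily B N)]
    refine Finset.card_le_card_of_injOn (fun z => z.1 * z.2 ^ 2) ?_ ?_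
    · intro z hz
      obtain ⟨i, hi, ⟨⟨h1, h2⟩, h3⟩, ⟨⟨h4, h5⟩, h6⟩, h7, h8, h9⟩ := hmem z hz
      rw [Finset.mem_coe, Set.Finite.mem_toFinset]
      refine mul_sq_mem_cubicTwistFamily h1 h4 h7 h8 h9
        ((isCoprime_of_dvd_sub_one h3).of_isCoprime_of_dvd_right hBW)
        ((isCoprime_of_dvd_sub_one h6).of_isCoprime_of_dvd_right hBW) ?_ ?_
      · omega
      · omega
    · intro z hz z' hz' h
      obtain ⟨i, hi, ⟨⟨h1, h2⟩, h3⟩, ⟨⟨h4, h5⟩, h6⟩, h7, h8, h9⟩ := hmem z hz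
      obtain ⟨i', hi', ⟨⟨h1', h2'⟩, h3'⟩, ⟨⟨h4', h5'⟩, h6'⟩, h7', h8', h9'⟩ := hmem z' hz'
      obtain ⟨e1, e2⟩ := mul_sq_injective h1 h4 h1' h4' h7 h7' h
      exact Prod.ext e1 e2
  refine le_trans ?_ (Nat.cast_le.2 hS)
  rw [Finset.card_biUnion]
  · push_cast
    rw [← nsmul_eq_mul, ← Finset.card_range t, ← Finset.sum_const, Finset.card_range]
    refine Finset.sum_le_sum fun i hi => ?_
    rw [Finset.mem_range] at hi
    obtain ⟨ha1, ha2⟩ := hM (r + 3 * i) (by omega)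
    obtain ⟨hb1, hb2⟩ := hM (N - (r + 3 * i)) (by omega)
    have := le_card_squarefreePairs hW hW3 ha1 hb1 ha2 hb2
    rwa [Nat.add_sub_cancel' (by omega)] at this
  · intro i _ j _ hij
    refine Finset.disjoint_left.2 fun z hz hz' => ?_
    simp only [squarefreePairs, Finset.mem_filter, Finset.mem_product, mem_monicsOneMod] at hz hz'
    have h1 := hz.1.1.1.2
    have h2 := hz'.1.1.1.2
    omega

theorem exists_sum_degPart_le {B : Fq[X]} (hB : B ≠ 0) :
    ∃ C : ℝ, ∀ N k : ℕ, ∑ D ∈ (finite_cubicTwistFamily B N).toFinset, (degPart D k : ℝ)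
      ≤ C * (cubicTwistFamily B N).ncard := by
  set V : Fq[X] := B * ∏ d ∈ Finset.range 4, ∏ P ∈ monicsOfDegree Fq d, P with hV
  have hV0 : V ≠ 0 := mul_ne_zero hB (Finset.prod_ne_zero_iff.2 fun d _ =>
    Finset.prod_ne_zero_iff.2 fun P hP => (mem_monicsOfDegree.1 hP).1.ne_zero)
  set W := normalize V
  have hW : W.Monic := monic_normalize hV0
  have hBW : B ∣ W := dvd_normalize_iff.2 (dvd_mul_right _ _)
  have hW3 : ∀ P : Fq[X], P.Monic → P.natDegree ≤ 3 → P ∣ W := fun P hP hP3 =>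
    dvd_normalize_iff.2 (((Finset.dvd_prod_of_mem (fun P => P) (mem_monicsOfDegree.2 ⟨hP, rfl⟩)).trans
      (Finset.dvd_prod_of_mem (fun d => ∏ P ∈ monicsOfDegree Fq d, P)
        (Finset.mem_range.2 (by omega)))).trans (dvd_mul_left _ _))
  set q : ℝ := ((Fintype.card Fq : ℕ) : ℝ) with hqdef
  have hq2 : 2 ≤ q := by
    rw [hqdef]; exact_mod_cast (Fintype.one_lt_card : 1 < Fintype.card Fq)
  obtain ⟨M₀, hM₀⟩ := exists_forall_mul_le_pow (by linarith : 1 < q) (q ^ (2 * W.natDegree))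
  set M := max M₀ (W.natDegree + 1)
  have hM : ∀ n : ℕ, M ≤ n → W.natDegree < n ∧ 64 * (n + 1) * q ^ (2 * W.natDegree) ≤ q ^ (n / 2) :=
    fun n hn => ⟨by omega, hM₀ n (by omega)⟩
  have hw : 0 < q ^ (2 * W.natDegree) := by positivity
  refine ⟨(4 * M + 8 : ℕ) + 24 * q ^ (2 * W.natDegree), fun N k => ?_⟩
  rw [add_mul]
  obtain hN | hN := le_total N (4 * M + 8)
  · refine le_add_of_le_of_nonneg ?_ (by positivity)
    rw [Set.ncard_eq_toFinset_card _ (finite_cubicTwistFamily B N), mul_comm, ← nsmul_eq_mul]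
    refine Finset.sum_le_card_nsmul _ _ _ fun D hD => ?_
    rw [Set.Finite.mem_toFinset] at hD
    exact_mod_cast (degPart_le_radDeg D k).trans (hD.2.2.2.1.le.trans hN)
  · refine le_add_of_nonneg_of_le (by positivity) ?_
    have h1 : ∑ D ∈ (finite_cubicTwistFamily B N).toFinset, (degPart D k : ℝ) ≤
        2 * (N + 1) * q ^ N := by
      rw [hqdef]; exact_mod_cast sum_degPart_cubicTwistFamily_le B N k
    have h2 := le_ncard_cubicTwistFamily hW hW3 hBW hM N
    have h3 : (N + 1 : ℝ) ≤ 6 * ((N - 2 * M) / 3 : ℕ) := by exact_mod_cast (by omega)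
    calc _ ≤ 2 * (N + 1) * q ^ N := h1
      _ ≤ 2 * (6 * ((N - 2 * M) / 3 : ℕ)) * q ^ N := by gcongr
      _ = 24 * q ^ (2 * W.natDegree) * (((N - 2 * M) / 3 : ℕ) *
            (q ^ N / (2 * q ^ (2 * W.natDegree)))) := by field_simp; ring
      _ ≤ _ := by gcongr

end Counting

/-- Lemma 2.5 of the paper:
`∑_{D ∈ F_N(B)} n ∑_{d ∣ n} deg(D_{n/d}) ≤ C · n · τ(n) · #F_N(B)`. -/
theorem bad_prime_average_bound
    (Fq : Type*) [Field Fq] [Fintype Fq] [DecidableEq Fq]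
    (B : Fq[X]) (hB : B ≠ 0) :
    ∃ C : ℝ, ∀ n N : ℕ, 1 ≤ n → 1 ≤ N →
      (∑ᶠ D ∈ cubicTwistFamily B N,
          ((n * ∑ d ∈ n.divisors, degPart D (n / d) : ℕ) : ℝ)) ≤
        C * n * (n.divisors.card : ℝ) * ((cubicTwistFamily B N).ncard : ℝ) := by
  obtain ⟨C, hC⟩ := exists_sum_degPart_le hB
  refine ⟨C, fun n N hn _ => ?_⟩
  rw [finsum_mem_eq_finite_toFinset_sum _ (finite_cubicTwistFamily B N)]
  push_cast
  rw [← Finset.mul_sum, Finset.sum_comm]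
  calc (n : ℝ) * ∑ d ∈ n.divisors,
        ∑ D ∈ (finite_cubicTwistFamily B N).toFinset, (degPart D (n / d) : ℝ)
      ≤ n * ∑ d ∈ n.divisors, C * (cubicTwistFamily B N).ncard := by
        gcongr with d
        exact hC N (n / d)
    _ = _ := by rw [Finset.sum_const, nsmul_eq_mul]; ring
end

section
/- Let 𝔽_q be a finite field. There exists a constant C (depending only on q) such that for every nonzero B ∈ 𝔽_q[T], every N ≥ 1 and every monic irreducible P ∈ 𝔽_q[T]: if deg(P) > N then no D ∈ F_N(B) is divisible by P, and if deg(P) ≤ N then #{D ∈ F_N(B) : P ∣ D} ≤ C · (N − deg(P) + 1) · q^{N − deg(P)}. -/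
open Polynomial UniqueFactorizationMonoid

theorem Polynomial.CubeFree.exists_eq_mul_sq {Fq : Type*} [Field Fq] [DecidableEq Fq] {D : Fq[X]}
    (hD : D.Monic) (hcube : D.CubeFree) :
    ∃ A E : Fq[X], A.Monic ∧ E.Monic ∧ D = A * E ^ 2 ∧ D.radDeg = A.natDegree + E.natDegree := by
  set M := normalizedFactors D with hM
  have hprod : M.prod = D := by
    rw [hM, prod_normalizedFactors_eq hD.ne_zero, hD.normalize_eq_self]
  have hmonic : ∀ Q ∈ M.toFinset, Q.Monic := fun Q hQ => by
    have hQ' : Q ∈ normalizedFactors D := Multiset.mem_toFinset.mp hQ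
    rw [← normalize_normalized_factor Q hQ']
    exact monic_normalize (irreducible_of_normalized_factor Q hQ').ne_zero
  have hcount : ∀ Q ∈ M.toFinset, M.count Q = 1 ∨ M.count Q = 2 := fun Q hQ => by
    have hQ' : Q ∈ M := Multiset.mem_toFinset.mp hQ
    have hpos := Multiset.count_pos.mpr hQ'
    have hlt : M.count Q < 3 := by
      by_contra! h
      apply hcube Q (hmonic Q hQ) (irreducible_of_normalized_factor Q hQ')
      rw [← hprod, ← Multiset.prod_replicate]
      exact Multiset.prod_dvd_prod_of_le (Multiset.le_count_iff_replicate_le.mp h)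
    omega
  have hmonic' (p : Fq[X] → Prop) [DecidablePred p] : ∀ Q ∈ M.toFinset.filter p, Q.Monic :=
    fun Q hQ => hmonic Q (Finset.mem_filter.mp hQ).1
  refine ⟨∏ Q ∈ M.toFinset with M.count Q = 1, Q, ∏ Q ∈ M.toFinset with ¬M.count Q = 1, Q,
    monic_prod_of_monic _ _ (hmonic' _), monic_prod_of_monic _ _ (hmonic' _), ?_, ?_⟩
  · rw [← Finset.prod_pow]
    conv_lhs => rw [← hprod, Finset.prod_multiset_count,
      ← Finset.prod_filter_mul_prod_filter_not _ (fun Q => M.count Q = 1)]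
    congr 1
    · refine Finset.prod_congr rfl fun Q hQ => ?_
      rw [(Finset.mem_filter.mp hQ).2, pow_one]
    · refine Finset.prod_congr rfl fun Q hQ => ?_
      rw [(hcount Q (Finset.mem_filter.mp hQ).1).resolve_left (Finset.mem_filter.mp hQ).2]
  · rw [natDegree_prod_of_monic _ _ (hmonic' _), natDegree_prod_of_monic _ _ (hmonic' _),
      Finset.sum_filter_add_sum_filter_not]
    rfl

theorem Polynomial.CubeFree.exists_eq_prime_mul {Fq : Type*} [Field Fq] [DecidableEq Fq]
    {D P : Fq[X]} (hD : D.Monic) (hcube : D.CubeFree) (hP : P.Monic) (hirr : Irreducible P)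
    (hdvd : P ∣ D) :
    ∃ A E : Fq[X], A.Monic ∧ E.Monic ∧ D.radDeg = P.natDegree + (A.natDegree + E.natDegree) ∧
      (D = P * A * E ^ 2 ∨ D = A * (P * E) ^ 2) := by
  obtain ⟨A, E, hA, hE, rfl, hdeg⟩ := hcube.exists_eq_mul_sq hD
  rcases hirr.prime.dvd_or_dvd hdvd with ⟨A, rfl⟩ | h
  · have hA' := hP.of_mul_monic_left hA
    exact ⟨A, E, hA', hE, by rw [hdeg, hP.natDegree_mul hA', add_assoc], Or.inl rfl⟩
  · obtain ⟨E, rfl⟩ := hirr.prime.dvd_of_dvd_pow h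
    have hE' := hP.of_mul_monic_left hE
    exact ⟨A, E, hA, hE', by rw [hdeg, hP.natDegree_mul hE', add_left_comm], Or.inr rfl⟩

theorem Polynomial.card_monic_natDegree_eq (Fq : Type*) [Field Fq] [Fintype Fq] (n : ℕ) :
    Nat.card {p : Fq[X] // p.Monic ∧ p.natDegree = n} = Fintype.card Fq ^ n := by
  rw [Nat.card_congr ((monicEquivDegreeLT n).trans (degreeLTEquiv Fq n).toEquiv)]
  simp

theorem Polynomial.finite_monic_natDegree_eq (Fq : Type*) [Field Fq] [Finite Fq] (n : ℕ) :
    {p : Fq[X] | p.Monic ∧ p.natDegree = n}.Finite :=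
  @Set.toFinite _ _ <| Finite.of_equiv _
    ((monicEquivDegreeLT n).trans (degreeLTEquiv Fq n).toEquiv).symm

/-- The pairs of monic polynomials whose degrees add up to `n`. -/
def Polynomial.monicPairs (Fq : Type*) [Field Fq] (n : ℕ) : Set (Fq[X] × Fq[X]) :=
  {x | x.1.Monic ∧ x.2.Monic ∧ x.1.natDegree + x.2.natDegree = n}

theorem Polynomial.monicPairs_eq_biUnion (Fq : Type*) [Field Fq] (n : ℕ) :
    monicPairs Fq n = ⋃ i ∈ Finset.HasAntidiagonal.antidiagonal n,
      {p : Fq[X] | p.Monic ∧ p.natDegree = i.1} ×ˢ {p : Fq[X] | p.Monic ∧ p.natDegree = i.2} := by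
  ext ⟨A, E⟩
  simp [monicPairs]

theorem Polynomial.finite_monicPairs (Fq : Type*) [Field Fq] [Finite Fq] (n : ℕ) :
    (monicPairs Fq n).Finite := by
  rw [monicPairs_eq_biUnion]
  exact (Finset.finite_toSet _).biUnion fun i _ =>
    (finite_monic_natDegree_eq Fq i.1).prod (finite_monic_natDegree_eq Fq i.2)

theorem Polynomial.ncard_monicPairs_le (Fq : Type*) [Field Fq] [Fintype Fq] (n : ℕ) :
    (monicPairs Fq n).ncard ≤ (n + 1) * Fintype.card Fq ^ n := by
  rw [monicPairs_eq_biUnion]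
  refine (Finset.set_ncard_biUnion_le _ _).trans (le_of_eq ?_)
  rw [← Finset.Nat.card_antidiagonal n, ← smul_eq_mul]
  refine Finset.sum_eq_card_nsmul fun i hi => ?_
  rw [Set.ncard_prod, ← Finset.HasAntidiagonal.mem_antidiagonal.mp hi, pow_add]
  congr 1 <;> exact card_monic_natDegree_eq Fq _

/-- Remark 4.8 of the paper: there is `C = C(q)` such that for all nonzero `B`, all `N ≥ 1`
and all monic irreducible `P`: if `deg P > N` then no `D ∈ F_N(B)` is divisible by `P`,
while if `deg P ≤ N` then
`#{D ∈ F_N(B) : P ∣ D} ≤ C·(N - deg P + 1)·q^{N - deg P}`. -/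
theorem divisible_by_prime_in_cubic_family_bound
    (Fq : Type*) [Field Fq] [Fintype Fq] [DecidableEq Fq] :
    ∃ C : ℝ, ∀ B : Fq[X], B ≠ 0 → ∀ N : ℕ, 1 ≤ N →
      ∀ P : Fq[X], P.Monic → Irreducible P →
        ((N < P.natDegree → ∀ D ∈ cubicTwistFamily B N, ¬P ∣ D) ∧
         (P.natDegree ≤ N →
           ({D ∈ cubicTwistFamily B N | P ∣ D}.ncard : ℝ) ≤
             C * ((N - P.natDegree : ℕ) + 1) *
               (Fintype.card Fq : ℝ) ^ (N - P.natDegree))) := by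
  refine ⟨2, fun B _ N _ P hP hirr => ⟨fun hlt D hD hdvd => ?_, fun hle => ?_⟩⟩
  · obtain ⟨hmon, hcube, -, hrad, -⟩ := hD
    obtain ⟨A, E, -, -, hdeg, -⟩ := hcube.exists_eq_prime_mul hmon hP hirr hdvd
    omega
  · set S := monicPairs Fq (N - P.natDegree)
    have hfin : S.Finite := finite_monicPairs Fq _
    have hsub : {D ∈ cubicTwistFamily B N | P ∣ D} ⊆
        (fun x : Fq[X] × Fq[X] => P * x.1 * x.2 ^ 2) '' S ∪
          (fun x : Fq[X] × Fq[X] => x.1 * (P * x.2) ^ 2) '' S := by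
      rintro D ⟨⟨hmon, hcube, -, hrad, -⟩, hdvd⟩
      obtain ⟨A, E, hA, hE, hdeg, hD⟩ := hcube.exists_eq_prime_mul hmon hP hirr hdvd
      have hmem : (A, E) ∈ S := ⟨hA, hE, by dsimp only; omega⟩
      exact hD.imp (fun h => ⟨(A, E), hmem, h.symm⟩) fun h => ⟨(A, E), hmem, h.symm⟩
    have hcard : {D ∈ cubicTwistFamily B N | P ∣ D}.ncard ≤
        2 * (N - P.natDegree + 1) * Fintype.card Fq ^ (N - P.natDegree) :=
      calc _ ≤ _ := Set.ncard_le_ncard hsub ((hfin.image _).union (hfin.image _))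
        _ ≤ _ := Set.ncard_union_le _ _
        _ ≤ S.ncard + S.ncard := add_le_add (Set.ncard_image_le hfin) (Set.ncard_image_le hfin)
        _ ≤ _ := by linarith [ncard_monicPairs_le Fq (N - P.natDegree)]
    exact_mod_cast hcard
end
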